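/- Let t₀ ∈ [0,T], and let f ∈ F be a convex function with ∂_v²f(x₀) = 0 at some point x₀ ∈ (0,∞)ⁿ and for some direction v ∈ ℝⁿ \ {0}. Then, for any ε > 0 there exists a convex function h ∈ F with ∂_v²h(x₀) = 0 such that ∂_v²(Ah)(x₀,t₀) = ∂_v²(Af)(x₀,t₀) and |∂_v²(Bh)(x₀,t₀)| ≤ ε. Consequently, if the operator M = A + B is LCP at all points of (0,∞)ⁿ × [0,T], then A is LCP at all points. -/

import Mathlib

open MeasureTheory Set Matrix NNReal

noncomputable section

/-- The open positive orthant `(0,∞)ⁿ` in `ℝⁿ`. -/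
def posOrth (n : ℕ) : Set (Fin n → ℝ) := {x | ∀ i, 0 < x i}

/-- First directional derivative of `f` at `x` in direction `v`. -/
def dir1 {n : ℕ} {F : Type*} [NormedAddCommGroup F] [NormedSpace ℝ F]
    (f : (Fin n → ℝ) → F) (x v : Fin n → ℝ) : F :=
  fderiv ℝ f x v

/-- Mixed second derivative: differentiate `f` in direction `v`, then in direction `w`. -/
def dmix {n : ℕ} {F : Type*} [NormedAddCommGroup F] [NormedSpace ℝ F]
    (f : (Fin n → ℝ) → F) (x v w : Fin n → ℝ) : F :=
  fderiv ℝ (fun y => fderiv ℝ f y v) x w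

/-- Second directional derivative of `f` at `x` in direction `v`. -/
def dir2 {n : ℕ} {F : Type*} [NormedAddCommGroup F] [NormedSpace ℝ F]
    (f : (Fin n → ℝ) → F) (x v : Fin n → ℝ) : F :=
  dmix f x v v

/-- The class `F` of test functions: `C⁴` on the positive orthant, with locally Hölder
continuous fourth derivatives, and with `f` together with its derivatives up to order two
of at most polynomial growth. -/
structure MemTestClass (n : ℕ) (f : (Fin n → ℝ) → ℝ) : Prop where
  smooth : ContDiffOn ℝ 4 f (posOrth n)
  holder4 : ∃ α : ℝ≥0, 0 < α ∧ (α : ℝ) ≤ 1 ∧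
    ∀ x ∈ posOrth n, ∃ s ∈ nhds x, s ⊆ posOrth n ∧
      ∃ C : ℝ≥0, HolderOnWith C α (iteratedFDeriv ℝ 4 f) s
  polyGrowth : ∃ C m : ℝ, ∀ x ∈ posOrth n, ∀ k : ℕ, k ≤ 2 →
    ‖iteratedFDeriv ℝ k f x‖ ≤ C * (1 + ‖x‖ ^ m)

/-- The jump structure `φ(x,t,z)` together with the standing assumptions (A3), (A6), (A7). -/
structure JumpKernel (n : ℕ) (T : ℝ) where
  φ : (Fin n → ℝ) → ℝ → ℝ → (Fin n → ℝ)
  meas : ∀ x ∈ posOrth n, ∀ t ∈ Icc (0:ℝ) T, Measurable (fun z => φ x t z)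
  smooth : ∀ t ∈ Icc (0:ℝ) T, ∀ z ∈ Icc (0:ℝ) 1,
    ContDiffOn ℝ 2 (fun x => φ x t z) (posOrth n)
  holder2 : ∃ α : ℝ≥0, 0 < α ∧ (α : ℝ) ≤ 1 ∧
    ∀ t ∈ Icc (0:ℝ) T, ∀ x ∈ posOrth n, ∃ s ∈ nhds x, s ⊆ posOrth n ∧
      ∃ C : ℝ≥0, ∀ z ∈ Icc (0:ℝ) 1,
        HolderOnWith C α (iteratedFDeriv ℝ 2 (fun y => φ y t z)) s
  bound : ∃ D : ℝ, 0 < D ∧ ∀ x ∈ posOrth n, ∀ t ∈ Icc (0:ℝ) T, ∀ z ∈ Icc (0:ℝ) 1,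
    ∀ i, (φ x t z i) ^ 2 ≤ D * (x i) ^ 2
  lower : ∃ γ₀ : ℝ, -1 < γ₀ ∧ ∀ x ∈ posOrth n, ∀ t ∈ Icc (0:ℝ) T, ∀ z ∈ Icc (0:ℝ) 1,
    ∀ i, γ₀ * x i < φ x t z i

/-- For each fixed `(x,t)`, `φ(x,t,z) ≠ 0` for almost every `z ∈ [0,1]`. -/
def JumpKernel.AENonzero {n : ℕ} {T : ℝ} (K : JumpKernel n T) : Prop :=
  ∀ x ∈ posOrth n, ∀ t ∈ Icc (0:ℝ) T,
    ∀ᵐ z ∂(volume.restrict (Icc (0:ℝ) 1)), K.φ x t z ≠ 0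

/-- The jump intensity `λ` : nonnegative and Hölder continuous on `[0,T]`. -/
def LamOK (T : ℝ) (lam : ℝ → ℝ) : Prop :=
  (∀ t ∈ Icc (0:ℝ) T, 0 ≤ lam t) ∧
  ∃ α C : ℝ≥0, 0 < α ∧ (α : ℝ) ≤ 1 ∧ HolderOnWith C α lam (Icc (0:ℝ) T)

/-- The integro-differential jump operator `B`. -/
def Bop {n : ℕ} {T : ℝ} (lam : ℝ → ℝ) (K : JumpKernel n T)
    (f : (Fin n → ℝ) → ℝ) (x : Fin n → ℝ) (t : ℝ) : ℝ :=
  lam t * ∫ z in Icc (0:ℝ) 1,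
    (f (x + K.φ x t z) - f x - fderiv ℝ f x (K.φ x t z))

/-- The diffusion matrix `β(x,t)` together with the standing assumptions (A1), (A3), (A5). -/
structure DiffKernel (n : ℕ) (T : ℝ) where
  β : (Fin n → ℝ) → ℝ → Matrix (Fin n) (Fin n) ℝ
  smooth : ∀ t ∈ Icc (0:ℝ) T, ∀ i j, ContDiffOn ℝ 2 (fun x => β x t i j) (posOrth n)
  holder2 : ∃ α : ℝ≥0, 0 < α ∧ (α : ℝ) ≤ 1 ∧
    ∀ t ∈ Icc (0:ℝ) T, ∀ i j, ∀ x ∈ posOrth n, ∃ s ∈ nhds x, s ⊆ posOrth n ∧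
      ∃ C : ℝ≥0, HolderOnWith C α (iteratedFDeriv ℝ 2 (fun y => β y t i j)) s
  nonsing : ∀ x ∈ posOrth n, ∀ t ∈ Icc (0:ℝ) T, (β x t).det ≠ 0
  bound : ∃ D : ℝ, 0 < D ∧ ∀ x ∈ posOrth n, ∀ t ∈ Icc (0:ℝ) T,
    ∀ i, ∑ j, (β x t i j) ^ 2 ≤ D * (x i) ^ 2

/-- The second order differential operator `A` with coefficient matrix `a = ββ*/2`. -/
def Aop {n : ℕ} {T : ℝ} (Dk : DiffKernel n T)
    (f : (Fin n → ℝ) → ℝ) (x : Fin n → ℝ) (t : ℝ) : ℝ :=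
  ∑ i, ∑ j, ((Dk.β x t * (Dk.β x t)ᵀ) i j / 2) *
    dmix f x (Pi.single i 1) (Pi.single j 1)

/-- An operator `D` (mapping a test function `f` to a function of `(x,t)`) is locally
convexity preserving (LCP) at `(x,t)` if `∂_v²(Df)(x,t) ≥ 0` for every direction `v ≠ 0`
and every convex `f ∈ F` with `∂_v²f(x) = 0`. -/
def IsLCPAt {n : ℕ} (D : ((Fin n → ℝ) → ℝ) → (Fin n → ℝ) → ℝ → ℝ)
    (x : Fin n → ℝ) (t : ℝ) : Prop :=
  ∀ v : Fin n → ℝ, v ≠ 0 → ∀ f : (Fin n → ℝ) → ℝ,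
    MemTestClass n f → ConvexOn ℝ (posOrth n) f → dir2 f x v = 0 →
    0 ≤ dir2 (fun y => D f y t) x v

/-- The integrand in condition (ohly) of Theorem 5.1. -/
def ohlyIntegrand {n : ℕ} {T : ℝ} (K : JumpKernel n T)
    (f : (Fin n → ℝ) → ℝ) (x v : Fin n → ℝ) (t z : ℝ) : ℝ :=
  dmix f (x + K.φ x t z) v v
    + 2 * dmix f (x + K.φ x t z) v (dir1 (fun y => K.φ y t z) x v)
    + dmix f (x + K.φ x t z) (dir1 (fun y => K.φ y t z) x v)
        (dir1 (fun y => K.φ y t z) x v)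
    + (fderiv ℝ f (x + K.φ x t z) (dir2 (fun y => K.φ y t z) x v)
        - fderiv ℝ f x (dir2 (fun y => K.φ y t z) x v))

open Filter Topology

open Filter Topology

section SecondDerivative

variable {E F : Type*} [NormedAddCommGroup E] [NormedSpace ℝ E]
  [NormedAddCommGroup F] [NormedSpace ℝ F]

theorem hasDerivAt_comp_line {f : E → F} {x v : E} {t : ℝ}
    (hf : DifferentiableAt ℝ f (x + t • v)) :
    HasDerivAt (fun s : ℝ => f (x + s • v)) (fderiv ℝ f (x + t • v) v) t := by
  have h : HasDerivAt (fun s : ℝ => x + s • v) v t := by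
    simpa using ((hasDerivAt_id t).smul_const v).const_add x
  exact hf.hasFDerivAt.comp_hasDerivAt t h

theorem hasDerivAt_fderiv_comp_line {f : E → F} {x v w : E} {t : ℝ}
    (hf : DifferentiableAt ℝ (fderiv ℝ f) (x + t • v)) :
    HasDerivAt (fun s : ℝ => fderiv ℝ f (x + s • v) w)
      (fderiv ℝ (fderiv ℝ f) (x + t • v) v w) t := by
  simpa using (hasDerivAt_comp_line hf).clm_apply (hasDerivAt_const t w)

theorem ContDiffAt.differentiableAt_fderiv {f : E → F} {x : E} (hf : ContDiffAt ℝ 2 f x) :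
    DifferentiableAt ℝ (fderiv ℝ f) x :=
  (hf.fderiv_right (m := 1) (by norm_num)).differentiableAt (by norm_num)

theorem ConvexOn.fderiv_fderiv_nonneg {f : E → ℝ} {U : Set E} (hU : IsOpen U)
    (hf : ContDiffOn ℝ 2 f U) (hc : ConvexOn ℝ U f) {x : E} (hx : x ∈ U) (v : E) :
    0 ≤ fderiv ℝ (fderiv ℝ f) x v v := by
  have hd : ∀ y ∈ U, ContDiffAt ℝ 2 f y := fun y hy => hf.contDiffAt (hU.mem_nhds hy)
  let L : ℝ →ᵃ[ℝ] E := AffineMap.lineMap x (x + v)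
  have hL : ∀ t, L t = x + t • v := fun t => by simp [L, AffineMap.lineMap_apply, add_comm]
  have hLc : Continuous L := by
    have : (L : ℝ → E) = fun t => x + t • v := funext hL
    rw [this]; fun_prop
  have hS : IsOpen (L ⁻¹' U) := hU.preimage hLc
  have hconv : ConvexOn ℝ (L ⁻¹' U) (f ∘ L) := hc.comp_affineMap L
  have hcomp : f ∘ L = fun t => f (x + t • v) := funext fun t => by simp [hL]
  have hder : ∀ t ∈ L ⁻¹' U, HasDerivAt (f ∘ L) (fderiv ℝ f (x + t • v) v) t := by
    intro t ht
    rw [hcomp]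
    refine hasDerivAt_comp_line ((hd _ ?_).differentiableAt (by norm_num))
    rwa [← hL]
  have hmono := hconv.monotoneOn_deriv fun t ht => (hder t ht).differentiableAt
  have h0 : (0 : ℝ) ∈ L ⁻¹' U := by simpa [hL] using hx
  have hnn := hmono.derivWithin_nonneg (x := 0)
  rw [derivWithin_of_isOpen hS h0] at hnn
  have heq : deriv (f ∘ L) =ᶠ[𝓝 0] fun t => fderiv ℝ f (x + t • v) v := by
    filter_upwards [hS.mem_nhds h0] with t ht using (hder t ht).deriv
  have h2 := hasDerivAt_fderiv_comp_line (f := f) (x := x) (v := v) (w := v) (t := 0)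
    (by simpa using (hd x hx).differentiableAt_fderiv)
  rw [heq.deriv_eq, h2.deriv] at hnn
  simpa using hnn

theorem convexOn_univ_of_fderiv_fderiv_nonneg {f : E → ℝ} (hf : ContDiff ℝ 2 f)
    (h : ∀ x v, 0 ≤ fderiv ℝ (fderiv ℝ f) x v v) : ConvexOn ℝ univ f := by
  have hd : ∀ y, ContDiffAt ℝ 2 f y := fun y => hf.contDiffAt
  refine ⟨convex_univ, fun x _ y _ a b ha hb hab => ?_⟩
  have h1 : ∀ t : ℝ, HasDerivAt (fun s : ℝ => f (x + s • (y - x)))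
      (fderiv ℝ f (x + t • (y - x)) (y - x)) t := fun t =>
    hasDerivAt_comp_line ((hd _).differentiableAt (by norm_num))
  have h2 : ∀ t : ℝ, HasDerivAt (fun s : ℝ => fderiv ℝ f (x + s • (y - x)) (y - x))
      (fderiv ℝ (fderiv ℝ f) (x + t • (y - x)) (y - x) (y - x)) t := fun t =>
    hasDerivAt_fderiv_comp_line (hd _).differentiableAt_fderiv
  have h1' : deriv (fun s : ℝ => f (x + s • (y - x))) =
      fun t => fderiv ℝ f (x + t • (y - x)) (y - x) := funext fun t => (h1 t).deriv
  have hc : ConvexOn ℝ univ (fun s : ℝ => f (x + s • (y - x))) := by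
    refine convexOn_univ_of_deriv2_nonneg (fun t => (h1 t).differentiableAt) ?_ ?_
    · rw [h1']; exact fun t => (h2 t).differentiableAt
    · intro t
      simp only [Function.iterate_succ, Function.iterate_zero, Function.comp_apply, id]
      rw [h1', (h2 t).deriv]
      exact h _ _
  have := hc.2 (mem_univ 0) (mem_univ 1) ha hb hab
  simp only [smul_eq_mul, mul_zero, mul_one, zero_add, zero_smul, add_zero, one_smul,
    add_sub_cancel] at this
  have e : x + b • (y - x) = a • x + b • y := by
    rw [← eq_sub_iff_add_eq] at hab
    rw [hab]; module
  rwa [e] at this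

theorem ContinuousLinearMap.apply_eq_zero_of_nonneg {B : E →L[ℝ] E →L[ℝ] ℝ}
    (hsymm : ∀ u w, B u w = B w u) (hnn : ∀ u, 0 ≤ B u u) {v : E} (hv : B v v = 0) (w : E) :
    B v w = 0 := by
  by_contra hne
  have key : ∀ s : ℝ, 0 ≤ 2 * s * B v w + B w w := fun s => by
    have := hnn (s • v + w)
    simp only [map_add, map_smul, _root_.add_apply, _root_.smul_apply,
      smul_eq_mul, hv, hsymm w v] at this
    linarith
  have := key (-(B w w + 1) / (2 * B v w))
  have e : 2 * (-(B w w + 1) / (2 * B v w)) * B v w = -(B w w + 1) := by field_simp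
  rw [e] at this
  linarith

theorem fderiv_fderiv_symm {f : E → F} {x : E} (hf : ContDiffAt ℝ 2 f x) (u w : E) :
    fderiv ℝ (fderiv ℝ f) x u w = fderiv ℝ (fderiv ℝ f) x w u :=
  hf.isSymmSndFDerivAt (by simp) u w

/-- A function that is twice differentiable at `x` and of third order there has vanishing second
derivative. -/
theorem fderiv_fderiv_apply_eq_zero_of_cubic {f : E → ℝ} {x : E} (hf : ContDiffAt ℝ 2 f x)
    {C : ℝ} (hC : ∀ᶠ y in 𝓝 x, |f y| ≤ C * ‖y - x‖ ^ 3) (v : E) :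
    fderiv ℝ (fderiv ℝ f) x v v = 0 := by
  have key : ∀ g : E → ℝ, ContDiffAt ℝ 2 g x → (∀ᶠ y in 𝓝 x, |g y| ≤ C * ‖y - x‖ ^ 3) →
      fderiv ℝ (fderiv ℝ g) x v v ≤ 0 := by
    intro g hg hgC
    by_contra! hpos
    set c := fderiv ℝ (fderiv ℝ g) x v v / 4 with hc
    have hline : Tendsto (fun t : ℝ => x + t • v) (𝓝 0) (𝓝 x) := by
      have : Continuous (fun t : ℝ => x + t • v) := by fun_prop
      simpa using this.tendsto 0
    have hgx : g x = 0 := by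
      have := hgC.self_of_nhds
      simpa using this
    have hnear : ∀ᶠ y in 𝓝 x, ContDiffAt ℝ 2 g y := hg.eventually (by simp)
    have h1 : ∀ᶠ t in 𝓝 (0 : ℝ), HasDerivAt (fun s : ℝ => g (x + s • v) - c * s ^ 2)
        (fderiv ℝ g (x + t • v) v - c * (2 * t)) t := by
      filter_upwards [hline.eventually hnear] with t ht
      have := (hasDerivAt_pow 2 t).const_mul c
      simpa using (hasDerivAt_comp_line (ht.differentiableAt (by norm_num))).fun_sub this
    have h2 : HasDerivAt (fun t : ℝ => fderiv ℝ g (x + t • v) v - c * (2 * t))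
        (fderiv ℝ (fderiv ℝ g) x v v - c * 2) 0 := by
      have a := hasDerivAt_fderiv_comp_line (f := g) (x := x) (v := v) (w := v) (t := 0)
        (by simpa using hg.differentiableAt_fderiv)
      have b := ((hasDerivAt_id (0 : ℝ)).const_mul 2).const_mul c
      simpa using a.fun_sub b
    have hdg : fderiv ℝ g x v = 0 := by
      have h3 : HasDerivAt (fun s : ℝ => g (x + s • v)) (fderiv ℝ g x v) 0 := by
        simpa using hasDerivAt_comp_line (f := g) (x := x) (v := v) (t := 0)
          (by simpa using hg.differentiableAt (by norm_num))
      have h4 : HasDerivAt (fun s : ℝ => g (x + s • v)) 0 0 := by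
        rw [hasDerivAt_iff_isLittleO]
        simp only [zero_smul, add_zero, hgx, sub_zero, smul_zero]
        refine Asymptotics.IsBigO.trans_isLittleO (g := fun t : ℝ => t ^ 3) ?_ ?_
        · refine Asymptotics.IsBigO.of_bound (C * ‖v‖ ^ 3) ?_
          filter_upwards [hline.eventually hgC] with t ht
          rw [Real.norm_eq_abs]
          refine ht.trans (le_of_eq ?_)
          simp [norm_smul, mul_pow]; ring
        · simpa using Asymptotics.isLittleO_pow_id (𝕜 := ℝ) (n := 3) (by norm_num)
      exact h3.unique h4
    have hmin : IsLocalMin (fun s : ℝ => g (x + s • v) - c * s ^ 2) 0 := by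
      refine isLocalMin_of_deriv_deriv_pos ?_ ?_ ?_
      · have e : deriv (fun s : ℝ => g (x + s • v) - c * s ^ 2) =ᶠ[𝓝 0]
            fun t => fderiv ℝ g (x + t • v) v - c * (2 * t) := h1.mono fun t ht => ht.deriv
        rw [e.deriv_eq, h2.deriv]
        rw [hc]; linarith
      · rw [h1.self_of_nhds.deriv]; simp [hdg]
      · exact h1.self_of_nhds.continuousAt
    have hfin : ∀ᶠ t in 𝓝 (0 : ℝ), c * t ^ 2 ≤ C * ‖v‖ ^ 3 * |t| ^ 3 := by
      filter_upwards [hmin, hline.eventually hgC] with t ht ht'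
      simp only [zero_smul, add_zero, hgx] at ht
      have := (abs_le.1 ht').2
      simp only [add_sub_cancel_left, norm_smul, mul_pow, Real.norm_eq_abs] at this
      nlinarith
    have hsmall : ∀ᶠ t in 𝓝[>] (0 : ℝ), C * ‖v‖ ^ 3 * t < c := by
      have : Tendsto (fun t : ℝ => C * ‖v‖ ^ 3 * t) (𝓝 0) (𝓝 0) := by
        have : Continuous (fun t : ℝ => C * ‖v‖ ^ 3 * t) := by fun_prop
        simpa using this.tendsto 0
      exact (this.eventually_lt_const (by positivity)).filter_mono nhdsWithin_le_nhds
    obtain ⟨t, ⟨ht1, ht2⟩, ht3⟩ := ((hsmall.and (hfin.filter_mono nhdsWithin_le_nhds)).and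
      self_mem_nhdsWithin).exists
    have ht3 : 0 < t := ht3
    rw [abs_of_pos ht3] at ht2
    nlinarith [pow_pos ht3 2]
  have hneg := key (fun y => -f y) hf.neg (by simpa using hC)
  have e : fderiv ℝ (fderiv ℝ fun y => -f y) x v v = -fderiv ℝ (fderiv ℝ f) x v v := by
    have : fderiv ℝ (fun y => -f y) = fun y => -fderiv ℝ f y := funext fun y => fderiv_fun_neg
    rw [this, fderiv_fun_neg]; simp
  rw [e] at hneg
  exact le_antisymm (key f hf hC) (by linarith)

end SecondDerivative

section Directional

variable {n : ℕ} {F : Type*} [NormedAddCommGroup F] [NormedSpace ℝ F]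

theorem isOpen_posOrth (n : ℕ) : IsOpen (posOrth n) := by
  simp only [posOrth, ofPred_forall]
  exact isOpen_iInter_of_finite fun i => isOpen_lt continuous_const (continuous_apply i)

theorem convex_posOrth (n : ℕ) : Convex ℝ (posOrth n) := by
  intro x hx y hy a b ha hb hab i
  simp only [Pi.add_apply, Pi.smul_apply, smul_eq_mul]
  have hx := hx i
  have hy := hy i
  rcases ha.lt_or_eq with h | rfl
  · nlinarith [mul_pos h hx, mul_nonneg hb hy.le]
  · have : b = 1 := by linarith
    subst this; simpa using hy

theorem dmix_eq {f : (Fin n → ℝ) → F} {x : Fin n → ℝ}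
    (hf : DifferentiableAt ℝ (fderiv ℝ f) x) (v w : Fin n → ℝ) :
    dmix f x v w = fderiv ℝ (fderiv ℝ f) x w v := by
  rw [dmix, fderiv_clm_apply hf (differentiableAt_const v)]
  simp

theorem dir2_eq {f : (Fin n → ℝ) → F} {x : Fin n → ℝ}
    (hf : ContDiffAt ℝ 2 f x) (v : Fin n → ℝ) :
    dir2 f x v = fderiv ℝ (fderiv ℝ f) x v v :=
  dmix_eq hf.differentiableAt_fderiv v v

end Directional

section Barrier

variable {n : ℕ}

/-- The Euclidean inner product on `Fin n → ℝ` as a continuous bilinear map. -/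
def dotB (n : ℕ) : (Fin n → ℝ) →L[ℝ] (Fin n → ℝ) →L[ℝ] ℝ :=
  ∑ i, (ContinuousLinearMap.proj (R := ℝ) (φ := fun _ : Fin n => ℝ) i).smulRight
    (ContinuousLinearMap.proj (R := ℝ) (φ := fun _ : Fin n => ℝ) i)

theorem dotB_apply (y v : Fin n → ℝ) : dotB n y v = ∑ i, y i * v i := by
  simp [dotB]

theorem dotB_comm (y v : Fin n → ℝ) : dotB n y v = dotB n v y := by
  simp [dotB_apply, mul_comm]

theorem norm_dotB_apply_le (y : Fin n → ℝ) : ‖dotB n y‖ ≤ n * ‖y‖ := by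
  refine ContinuousLinearMap.opNorm_le_bound _ (by positivity) fun v => ?_
  rw [dotB_apply]
  refine (norm_sum_le _ _).trans ?_
  calc ∑ i, ‖y i * v i‖ ≤ ∑ _i : Fin n, ‖y‖ * ‖v‖ := by
        refine Finset.sum_le_sum fun i _ => ?_
        rw [norm_mul]
        exact mul_le_mul (norm_le_pi_norm y i) (norm_le_pi_norm v i) (norm_nonneg _)
          (norm_nonneg _)
    _ = n * ‖y‖ * ‖v‖ := by simp; ring

theorem norm_dotB_le : ‖dotB n‖ ≤ n :=
  ContinuousLinearMap.opNorm_le_bound _ (by positivity) norm_dotB_apply_le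

theorem sq_norm_le_dotB (y : Fin n → ℝ) : ‖y‖ ^ 2 ≤ dotB n y y := by
  have h0 : 0 ≤ dotB n y y := by
    rw [dotB_apply]; exact Finset.sum_nonneg fun i _ => mul_self_nonneg _
  have h1 : ‖y‖ ≤ √(dotB n y y) := by
    refine (pi_norm_le_iff_of_nonneg (Real.sqrt_nonneg _)).2 fun i => Real.abs_le_sqrt ?_
    rw [dotB_apply, pow_two]
    exact Finset.single_le_sum (f := fun i => y i * y i) (fun i _ => mul_self_nonneg _)
      (Finset.mem_univ i)
  exact (Real.le_sqrt (norm_nonneg y) h0).1 h1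

theorem dotB_self_le (y : Fin n → ℝ) : dotB n y y ≤ n * ‖y‖ ^ 2 := by
  have h := (dotB n y).le_opNorm y
  have h1 := (le_abs_self _).trans h
  nlinarith [norm_dotB_apply_le y, norm_nonneg y]

theorem dotB_sq_le (y v : Fin n → ℝ) : dotB n y v ^ 2 ≤ dotB n y y * dotB n v v := by
  simp only [dotB_apply, ← pow_two]
  exact Finset.sum_mul_sq_le_sq_mul_sq _ _ _

/-- The radial profile `s ↦ δ (w + 2δ²/w - δ⁴/(3w³))`, `w = √(δ² + s)`, of the barrier. -/
def profile (δ s : ℝ) : ℝ :=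
  δ * (√(δ ^ 2 + s) + 2 * δ ^ 2 * (√(δ ^ 2 + s))⁻¹ - δ ^ 4 / 3 * ((√(δ ^ 2 + s)) ^ 3)⁻¹)

/-- Twice the derivative of `profile`. -/
def slopeProfile (δ s : ℝ) : ℝ :=
  δ * s ^ 2 * (√(δ ^ 2 + s) ^ 5)⁻¹

/-- Twice the derivative of `slopeProfile`. -/
def curvProfile (δ s : ℝ) : ℝ :=
  δ * s * (4 * δ ^ 2 - s) * (√(δ ^ 2 + s) ^ 7)⁻¹

theorem hasDerivAt_profile {δ s : ℝ} (hδ : 0 < δ) (hs : 0 ≤ s) :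
    HasDerivAt (profile δ) (slopeProfile δ s / 2) s := by
  have hw : HasDerivAt (fun s => √(δ ^ 2 + s)) (1 / (2 * √(δ ^ 2 + s))) s :=
    ((hasDerivAt_id s).const_add (δ ^ 2)).sqrt (by simp; positivity)
  have hpos : 0 < √(δ ^ 2 + s) := Real.sqrt_pos.2 (by positivity)
  have hsq : √(δ ^ 2 + s) ^ 2 = δ ^ 2 + s := Real.sq_sqrt (by positivity)
  have h := ((hw.add ((hw.fun_inv hpos.ne').const_mul (2 * δ ^ 2))).sub
    (((hw.fun_pow 3).fun_inv (pow_pos hpos 3).ne').const_mul (δ ^ 4 / 3))).const_mul δ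
  refine h.congr_deriv ?_
  unfold slopeProfile
  set w := √(δ ^ 2 + s)
  have hs' : s = w ^ 2 - δ ^ 2 := by linarith
  rw [hs']
  field_simp
  ring

theorem hasDerivAt_slopeProfile {δ s : ℝ} (hδ : 0 < δ) (hs : 0 ≤ s) :
    HasDerivAt (slopeProfile δ) (curvProfile δ s / 2) s := by
  have hw : HasDerivAt (fun s => √(δ ^ 2 + s)) (1 / (2 * √(δ ^ 2 + s))) s :=
    ((hasDerivAt_id s).const_add (δ ^ 2)).sqrt (by simp; positivity)
  have hpos : 0 < √(δ ^ 2 + s) := Real.sqrt_pos.2 (by positivity)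
  have hsq : √(δ ^ 2 + s) ^ 2 = δ ^ 2 + s := Real.sq_sqrt (by positivity)
  have h := ((hasDerivAt_pow 2 s).const_mul δ).fun_mul
    ((hw.fun_pow 5).fun_inv (pow_pos hpos 5).ne')
  refine h.congr_deriv ?_
  unfold curvProfile
  set w := √(δ ^ 2 + s)
  have hs' : s = w ^ 2 - δ ^ 2 := by linarith
  rw [hs']
  field_simp
  ring

theorem hasFDerivAt_dotB_self (x₀ x : Fin n → ℝ) :
    HasFDerivAt (fun y => dotB n (y - x₀) (y - x₀)) ((2 : ℝ) • dotB n (x - x₀)) x := by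
  have h1 : HasFDerivAt (fun y => dotB n (y - x₀)) (dotB n) x :=
    (dotB n).hasFDerivAt.comp x (hasFDerivAt_sub_const x₀)
  have := h1.clm_apply (hasFDerivAt_sub_const (x := x) x₀)
  refine this.congr_fderiv ?_
  ext v
  simp [dotB_comm v, two_mul]

/-- A convex function with small gradient, whose Hessian is of fourth order at `x₀`, bounded below
on an annulus of size `δ` and decaying away from it. -/
def barrier (δ : ℝ) (x₀ x : Fin n → ℝ) : ℝ := profile δ (dotB n (x - x₀) (x - x₀))

theorem dotB_self_nonneg (y : Fin n → ℝ) : 0 ≤ dotB n y y :=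
  (sq_nonneg _).trans (sq_norm_le_dotB y)

theorem hasFDerivAt_barrier {δ : ℝ} (hδ : 0 < δ) (x₀ x : Fin n → ℝ) :
    HasFDerivAt (barrier δ x₀)
      (slopeProfile δ (dotB n (x - x₀) (x - x₀)) • dotB n (x - x₀)) x := by
  have := (hasDerivAt_profile hδ (dotB_self_nonneg (x - x₀))).comp_hasFDerivAt x
    (hasFDerivAt_dotB_self x₀ x)
  refine this.congr_fderiv ?_
  rw [smul_smul]; congr 1; ring

theorem fderiv_barrier {δ : ℝ} (hδ : 0 < δ) (x₀ : Fin n → ℝ) : fderiv ℝ (barrier δ x₀) =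
    fun x => slopeProfile δ (dotB n (x - x₀) (x - x₀)) • dotB n (x - x₀) :=
  funext fun x => (hasFDerivAt_barrier hδ x₀ x).fderiv

theorem fderiv_fderiv_barrier {δ : ℝ} (hδ : 0 < δ) (x₀ x : Fin n → ℝ) :
    fderiv ℝ (fderiv ℝ (barrier δ x₀)) x =
      slopeProfile δ (dotB n (x - x₀) (x - x₀)) • dotB n +
      curvProfile δ (dotB n (x - x₀) (x - x₀)) •
        (dotB n (x - x₀)).smulRight (dotB n (x - x₀)) := by
  rw [fderiv_barrier hδ]
  have h1 : HasFDerivAt (fun y => dotB n (y - x₀)) (dotB n) x :=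
    (dotB n).hasFDerivAt.comp x (hasFDerivAt_sub_const x₀)
  have h2 := (hasDerivAt_slopeProfile hδ (dotB_self_nonneg (x - x₀))).comp_hasFDerivAt x
    (hasFDerivAt_dotB_self x₀ x)
  have h3 := h2.fun_smul h1
  refine h3.fderiv.trans ?_
  ext u v
  simp only [Function.comp_apply, _root_.add_apply, _root_.smul_apply,
    ContinuousLinearMap.smulRight_apply, smul_eq_mul]
  ring

theorem contDiff_barrier {δ : ℝ} (hδ : 0 < δ) (x₀ : Fin n → ℝ) {m : WithTop ℕ∞} :
    ContDiff ℝ m (barrier δ x₀) := by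
  have hq : ContDiff ℝ m fun x => dotB n (x - x₀) (x - x₀) := by fun_prop
  have hpos : ∀ x, δ ^ 2 + dotB n (x - x₀) (x - x₀) ≠ 0 := fun x =>
    (add_pos_of_pos_of_nonneg (by positivity) (dotB_self_nonneg _)).ne'
  have hw : ContDiff ℝ m fun x => √(δ ^ 2 + dotB n (x - x₀) (x - x₀)) :=
    (contDiff_const.add hq).sqrt hpos
  have hw0 : ∀ x, √(δ ^ 2 + dotB n (x - x₀) (x - x₀)) ≠ 0 := fun x =>
    (Real.sqrt_pos.2 (add_pos_of_pos_of_nonneg (by positivity) (dotB_self_nonneg _))).ne'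
  unfold barrier profile
  exact contDiff_const.mul ((hw.add (contDiff_const.mul (hw.inv hw0))).sub
    (contDiff_const.mul ((hw.pow 3).inv fun x => pow_ne_zero 3 (hw0 x))))

theorem slopeProfile_nonneg {δ s : ℝ} (hδ : 0 < δ) : 0 ≤ slopeProfile δ s := by
  unfold slopeProfile; positivity

theorem slopeProfile_mul_sqrt_le {δ s : ℝ} (hδ : 0 < δ) (hs : 0 ≤ s) :
    slopeProfile δ s * √(δ ^ 2 + s) ≤ δ := by
  have hpos : 0 < √(δ ^ 2 + s) := Real.sqrt_pos.2 (by positivity)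
  have hsq : √(δ ^ 2 + s) ^ 2 = δ ^ 2 + s := Real.sq_sqrt (by positivity)
  unfold slopeProfile
  set w := √(δ ^ 2 + s)
  have e : δ * s ^ 2 * (w ^ 5)⁻¹ * w = δ * (s ^ 2 / (w ^ 2) ^ 2) := by field_simp
  rw [e]
  refine mul_le_of_le_one_right hδ.le (div_le_one_of_le₀ ?_ (by positivity))
  rw [hsq]; gcongr; nlinarith

theorem slopeProfile_le {δ s : ℝ} (hδ : 0 < δ) (hs : 0 ≤ s) :
    slopeProfile δ s ≤ s ^ 2 / δ ^ 4 := by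
  have hle : δ ≤ √(δ ^ 2 + s) := Real.le_sqrt_of_sq_le (by linarith)
  unfold slopeProfile
  have : (√(δ ^ 2 + s) ^ 5)⁻¹ ≤ (δ ^ 5)⁻¹ := by gcongr
  calc δ * s ^ 2 * (√(δ ^ 2 + s) ^ 5)⁻¹ ≤ δ * s ^ 2 * (δ ^ 5)⁻¹ := by gcongr
    _ = s ^ 2 / δ ^ 4 := by field_simp

theorem mul_abs_curvProfile_le {δ s : ℝ} (hδ : 0 < δ) (hs : 0 ≤ s) :
    s * |curvProfile δ s| ≤ 4 * slopeProfile δ s := by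
  have hpos : 0 < √(δ ^ 2 + s) := Real.sqrt_pos.2 (by positivity)
  have hsq : √(δ ^ 2 + s) ^ 2 = δ ^ 2 + s := Real.sq_sqrt (by positivity)
  unfold curvProfile slopeProfile
  set w := √(δ ^ 2 + s)
  rw [abs_mul, abs_mul, abs_of_nonneg (by positivity : 0 ≤ δ * s),
    abs_of_nonneg (by positivity : 0 ≤ (w ^ 7)⁻¹)]
  have h1 : |4 * δ ^ 2 - s| ≤ 4 * w ^ 2 := by
    rw [hsq, abs_le]; constructor <;> nlinarith
  calc s * (δ * s * |4 * δ ^ 2 - s| * (w ^ 7)⁻¹)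
      ≤ s * (δ * s * (4 * w ^ 2) * (w ^ 7)⁻¹) := by gcongr
    _ = 4 * (δ * s ^ 2 * (w ^ 5)⁻¹) := by field_simp

theorem norm_fderiv_fderiv_barrier_le {δ : ℝ} (hδ : 0 < δ) (x₀ x : Fin n → ℝ) :
    ‖fderiv ℝ (fderiv ℝ (barrier δ x₀)) x‖ ≤
      (n + 4 * n ^ 2) * slopeProfile δ (dotB n (x - x₀) (x - x₀)) := by
  rw [fderiv_fderiv_barrier hδ]
  set y := x - x₀
  set s := dotB n y y
  have hs : 0 ≤ s := dotB_self_nonneg y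
  have hk := slopeProfile_nonneg (s := s) hδ
  have hop : ∀ B : (Fin n → ℝ) →L[ℝ] ℝ, ‖B.smulRight B‖ = ‖B‖ * ‖B‖ := fun B =>
    ContinuousLinearMap.norm_smulRight_apply _ _
  refine (ContinuousLinearMap.opNorm_add_le _ _).trans ?_
  rw [norm_smul, norm_smul, hop, Real.norm_eq_abs,
    Real.norm_eq_abs, abs_of_nonneg hk]
  have h1 : ‖dotB n y‖ * ‖dotB n y‖ ≤ n ^ 2 * s := by
    have := norm_dotB_apply_le y
    calc _ ≤ (n * ‖y‖) * (n * ‖y‖) := by gcongr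
      _ = n ^ 2 * ‖y‖ ^ 2 := by ring
      _ ≤ _ := by gcongr; exact sq_norm_le_dotB y
  have h2 := mul_abs_curvProfile_le hδ hs
  have h3 : |curvProfile δ s| * (‖dotB n y‖ * ‖dotB n y‖) ≤
      n ^ 2 * (4 * slopeProfile δ s) := by
    calc _ ≤ |curvProfile δ s| * (n ^ 2 * s) := by gcongr
      _ = n ^ 2 * (s * |curvProfile δ s|) := by ring
      _ ≤ _ := by gcongr
  have h4 : slopeProfile δ s * ‖dotB n‖ ≤ slopeProfile δ s * n := by
    gcongr; exact norm_dotB_le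
  linarith

theorem le_fderiv_fderiv_barrier {δ : ℝ} (hδ : 0 < δ) (x₀ x v : Fin n → ℝ) :
    δ ^ 3 * dotB n (x - x₀) (x - x₀) ^ 2 *
        (√(δ ^ 2 + dotB n (x - x₀) (x - x₀)) ^ 7)⁻¹ * dotB n v v ≤
      fderiv ℝ (fderiv ℝ (barrier δ x₀)) x v v := by
  rw [fderiv_fderiv_barrier hδ]
  simp only [_root_.add_apply, _root_.smul_apply,
    ContinuousLinearMap.smulRight_apply, smul_eq_mul]
  have hcs := dotB_sq_le (x - x₀) v
  set y := x - x₀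
  set s := dotB n y y
  set q := dotB n v v
  set p := dotB n y v
  have hs : 0 ≤ s := dotB_self_nonneg y
  have hpos : 0 < √(δ ^ 2 + s) := Real.sqrt_pos.2 (by positivity)
  have hsq : √(δ ^ 2 + s) ^ 2 = δ ^ 2 + s := Real.sq_sqrt (by positivity)
  unfold slopeProfile curvProfile
  set w := √(δ ^ 2 + s)
  have e : δ * s ^ 2 * (w ^ 5)⁻¹ * q + δ * s * (4 * δ ^ 2 - s) * (w ^ 7)⁻¹ * (p * p) -
      δ ^ 3 * s ^ 2 * (w ^ 7)⁻¹ * q =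
      δ * s * (w ^ 7)⁻¹ * (s * (w ^ 2) * q + (4 * δ ^ 2 - s) * p ^ 2 - δ ^ 2 * s * q) := by
    field_simp
  rw [← sub_nonneg, e, hsq]
  refine mul_nonneg (by positivity) ?_
  nlinarith [mul_nonneg hs (sub_nonneg.2 hcs), sq_nonneg (δ * p)]

theorem fderiv_fderiv_barrier_nonneg {δ : ℝ} (hδ : 0 < δ) (x₀ x v : Fin n → ℝ) :
    0 ≤ fderiv ℝ (fderiv ℝ (barrier δ x₀)) x v v := by
  refine le_trans ?_ (le_fderiv_fderiv_barrier hδ x₀ x v)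
  have := dotB_self_nonneg v
  positivity

theorem le_fderiv_fderiv_barrier_of_annulus {δ : ℝ} (hδ : 0 < δ) {x₀ x : Fin n → ℝ}
    (h1 : δ ≤ ‖x - x₀‖) (h2 : ‖x - x₀‖ ≤ 2 * δ) (v : Fin n → ℝ) :
    ((1 + 4 * n : ℝ) ^ 7)⁻¹ * ‖v‖ ^ 2 ≤ fderiv ℝ (fderiv ℝ (barrier δ x₀)) x v v := by
  refine le_trans ?_ (le_fderiv_fderiv_barrier hδ x₀ x v)
  have hv := sq_norm_le_dotB v
  have hy := sq_norm_le_dotB (x - x₀)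
  have hy' := dotB_self_le (x - x₀)
  set s := dotB n (x - x₀) (x - x₀)
  have hs : δ ^ 2 ≤ s := le_trans (by gcongr) hy
  have hs' : s ≤ n * (2 * δ) ^ 2 := hy'.trans (by gcongr)
  have hpos : 0 < √(δ ^ 2 + s) := Real.sqrt_pos.2 (by nlinarith [pow_pos hδ 2])
  have hw : √(δ ^ 2 + s) ≤ (1 + 4 * n) * δ := by
    refine Real.sqrt_le_iff.2 ⟨by positivity, ?_⟩
    nlinarith [mul_nonneg (sq_nonneg δ) (Nat.cast_nonneg (α := ℝ) n),
      mul_nonneg (sq_nonneg δ) (sq_nonneg (n : ℝ))]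
  refine mul_le_mul ?_ hv (by positivity) (by positivity)
  calc ((1 + 4 * n : ℝ) ^ 7)⁻¹ = δ ^ 3 * (δ ^ 2) ^ 2 * (((1 + 4 * n) * δ) ^ 7)⁻¹ := by
        field_simp
    _ ≤ _ := by gcongr

theorem exists_barrier_bounds (n : ℕ) : ∃ C c : ℝ, 0 < C ∧ 0 < c ∧
    ∀ (x₀ : Fin n → ℝ) (δ : ℝ), 0 < δ →
      (∀ x, ‖fderiv ℝ (barrier δ x₀) x‖ ≤ C * δ) ∧
      (∀ x, ‖fderiv ℝ (fderiv ℝ (barrier δ x₀)) x‖ * (δ + ‖x - x₀‖) ≤ C * δ) ∧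
      (∀ x, ‖fderiv ℝ (fderiv ℝ (barrier δ x₀)) x‖ ≤ C / δ ^ 4 * ‖x - x₀‖ ^ 4) ∧
      ∀ x, δ ≤ ‖x - x₀‖ → ‖x - x₀‖ ≤ 2 * δ → ∀ v,
        c * ‖v‖ ^ 2 ≤ fderiv ℝ (fderiv ℝ (barrier δ x₀)) x v v := by
  refine ⟨2 * (n + 4 * n ^ 2) * (n ^ 2 + 1) + n + 1, ((1 + 4 * n : ℝ) ^ 7)⁻¹, by positivity,
    by positivity, fun x₀ δ hδ => ⟨fun x => ?_, fun x => ?_, fun x => ?_, fun x h1 h2 v =>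
    le_fderiv_fderiv_barrier_of_annulus hδ h1 h2 v⟩⟩
  all_goals
    have hs := dotB_self_nonneg (x - x₀)
    have hy := sq_norm_le_dotB (x - x₀)
    have hk := slopeProfile_nonneg (s := dotB n (x - x₀) (x - x₀)) hδ
    have hkw := slopeProfile_mul_sqrt_le hδ hs
    have hyw : ‖x - x₀‖ ≤ √(δ ^ 2 + dotB n (x - x₀) (x - x₀)) :=
      Real.le_sqrt_of_sq_le (by nlinarith [sq_nonneg δ])
    have hδw : δ ≤ √(δ ^ 2 + dotB n (x - x₀) (x - x₀)) :=
      Real.le_sqrt_of_sq_le (by nlinarith)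
  · rw [(hasFDerivAt_barrier hδ x₀ x).fderiv, norm_smul, Real.norm_eq_abs, abs_of_nonneg hk]
    have h1 : slopeProfile δ (dotB n (x - x₀) (x - x₀)) * ‖dotB n (x - x₀)‖ ≤
        slopeProfile δ (dotB n (x - x₀) (x - x₀)) *
          (n * √(δ ^ 2 + dotB n (x - x₀) (x - x₀))) := by
      gcongr
      exact (norm_dotB_apply_le _).trans (by gcongr)
    have h2 : (n : ℝ) * (slopeProfile δ (dotB n (x - x₀) (x - x₀)) *
        √(δ ^ 2 + dotB n (x - x₀) (x - x₀))) ≤ n * δ := by gcongr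
    have h3 : 0 ≤ (2 * (n + 4 * n ^ 2) * (n ^ 2 + 1) + 1 : ℝ) * δ := by positivity
    linarith
  · have h := norm_fderiv_fderiv_barrier_le hδ x₀ x
    set k := slopeProfile δ (dotB n (x - x₀) (x - x₀))
    set w := √(δ ^ 2 + dotB n (x - x₀) (x - x₀))
    calc _ ≤ ((n + 4 * n ^ 2) * k) * (w + w) := by gcongr
      _ = 2 * (n + 4 * n ^ 2) * (k * w) := by ring
      _ ≤ 2 * (n + 4 * n ^ 2) * δ := by gcongr
      _ ≤ _ := by
        gcongr
        have : (0 : ℝ) ≤ 2 * (n + 4 * n ^ 2) * n ^ 2 + n + 1 := by positivity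
        linarith
  · have h := norm_fderiv_fderiv_barrier_le hδ x₀ x
    have h1 := slopeProfile_le hδ hs
    have h2 := dotB_self_le (x - x₀)
    set k := slopeProfile δ (dotB n (x - x₀) (x - x₀))
    calc _ ≤ (n + 4 * n ^ 2) * ((n * ‖x - x₀‖ ^ 2) ^ 2 / δ ^ 4) := by
          refine h.trans ?_
          gcongr
          exact h1.trans (by gcongr)
      _ = (n + 4 * n ^ 2) * n ^ 2 / δ ^ 4 * ‖x - x₀‖ ^ 4 := by ring
      _ ≤ _ := by
        gcongr
        have : (0 : ℝ) ≤ (n + 4 * n ^ 2) * n ^ 2 + 2 * (n + 4 * n ^ 2) + n + 1 := by positivity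
        linarith

end Barrier

section Holder

variable {E F : Type*} [NormedAddCommGroup E] [NormedSpace ℝ E]
  [NormedAddCommGroup F] [NormedSpace ℝ F]

theorem holderOnWith_of_dist_le {X Y : Type*} [PseudoMetricSpace X] [PseudoMetricSpace Y]
    {f : X → Y} {s : Set X} {C α : ℝ≥0}
    (h : ∀ x ∈ s, ∀ y ∈ s, dist (f x) (f y) ≤ C * dist x y ^ (α : ℝ)) :
    HolderOnWith C α f s := by
  intro x hx y hy
  rw [edist_dist, edist_dist, ENNReal.ofReal_rpow_of_nonneg dist_nonneg α.coe_nonneg,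
    ← ENNReal.ofReal_coe_nnreal, ← ENNReal.ofReal_mul C.coe_nonneg]
  exact ENNReal.ofReal_le_ofReal (h x hx y hy)

/-- The iterated derivatives of `χ • f` and `χ` times those of `f` differ by terms that are one
degree smoother. -/
theorem contDiffAt_iteratedFDeriv_smul_sub {χ : E → ℝ} {f : E → F} {U : Set E} (hU : IsOpen U)
    {N : ℕ} (hχ : ContDiff ℝ (N + 1 : ℕ) χ) (hf : ContDiffOn ℝ N f U) (j : ℕ) :
    ∀ i : ℕ, i + j = N → ∀ x ∈ U, ContDiffAt ℝ (i + 1 : ℕ)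
      (fun y => iteratedFDeriv ℝ j (fun z => χ z • f z) y - χ y • iteratedFDeriv ℝ j f y) x := by
  have hf' : ∀ x ∈ U, ContDiffAt ℝ N f x := fun x hx => hf.contDiffAt (hU.mem_nhds hx)
  induction j with
  | zero =>
    intro i _ x _
    have : (fun y => iteratedFDeriv ℝ 0 (fun z => χ z • f z) y - χ y • iteratedFDeriv ℝ 0 f y) =
        fun _ => 0 := by
      ext y m; simp
    rw [this]
    exact contDiffAt_const
  | succ j ih =>
    intro i hij x hx
    set R := fun y => iteratedFDeriv ℝ j (fun z => χ z • f z) y - χ y • iteratedFDeriv ℝ j f y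
      with hR
    have hRc : ∀ y ∈ U, ContDiffAt ℝ (i + 1 + 1 : ℕ) R y := ih (i + 1) (by omega)
    have hDj : ∀ y ∈ U, ContDiffAt ℝ (i + 1 : ℕ) (iteratedFDeriv ℝ j f) y := fun y hy =>
      (hf' y hy).iteratedFDeriv_right (by norm_cast; omega)
    have hDj' : ∀ y ∈ U, DifferentiableAt ℝ (iteratedFDeriv ℝ j f) y := fun y hy =>
      (hDj y hy).differentiableAt (by simp)
    have hχd : ∀ y, DifferentiableAt ℝ χ y := fun y =>
      hχ.contDiffAt.differentiableAt (by simp)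
    let I : (E →L[ℝ] (E [×j]→L[ℝ] F)) →L[ℝ] (E [×(j + 1)]→L[ℝ] F) :=
      ((continuousMultilinearCurryLeftEquiv ℝ (fun _ : Fin (j + 1) => E) F).symm
        |>.toContinuousLinearEquiv : _ →L[ℝ] _)
    have key : (fun y => iteratedFDeriv ℝ (j + 1) (fun z => χ z • f z) y -
        χ y • iteratedFDeriv ℝ (j + 1) f y) =ᶠ[𝓝 x]
        fun y => I (fderiv ℝ R y + (fderiv ℝ χ y).smulRight (iteratedFDeriv ℝ j f y)) := by
      filter_upwards [hU.mem_nhds hx] with y hy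
      have hdec : iteratedFDeriv ℝ j (fun z => χ z • f z) =
          fun y => R y + χ y • iteratedFDeriv ℝ j f y := by
        ext1 y; simp [hR]
      have h1 := ((hRc y hy).differentiableAt (by simp)).hasFDerivAt.fun_add
        ((hχd y).hasFDerivAt.fun_smul (hDj' y hy).hasFDerivAt)
      rw [iteratedFDeriv_succ_eq_comp_left, iteratedFDeriv_succ_eq_comp_left,
        Function.comp_apply, Function.comp_apply, hdec, h1.fderiv]
      change I (fderiv ℝ R y + (χ y • fderiv ℝ (iteratedFDeriv ℝ j f) y +
        (fderiv ℝ χ y).smulRight (iteratedFDeriv ℝ j f y))) -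
        χ y • I (fderiv ℝ (iteratedFDeriv ℝ j f) y) = I _
      rw [← map_smul, ← map_sub]
      congr 1
      abel
    refine ContDiffAt.congr_of_eventuallyEq ?_ key
    let J : (E →L[ℝ] (E [×j]→L[ℝ] F)) ≃ₗᵢ[ℝ] (E [×(j + 1)]→L[ℝ] F) :=
      (continuousMultilinearCurryLeftEquiv ℝ (fun _ : Fin (j + 1) => E) F).symm
    have hI : ContDiff ℝ (i + 1 : ℕ) fun q => I q :=
      LinearIsometryEquiv.contDiff (𝕜 := ℝ) (E := E →L[ℝ] (E [×j]→L[ℝ] F))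
        (F := E [×(j + 1)]→L[ℝ] F) J
    refine hI.contDiffAt.comp x (ContDiffAt.add ?_ ?_)
    · exact (hRc x hx).fderiv_right (by norm_cast)
    · refine ContDiffAt.smulRight ?_ (hDj x hx)
      exact hχ.contDiffAt.fderiv_right (by norm_cast; omega)

/-- Multiplying by a smooth function and adding a smooth function preserves local Hölder
continuity of the top order derivative. -/
theorem exists_holderOnWith_iteratedFDeriv_smul_add {χ : E → ℝ} {f S : E → F} {U : Set E}
    (hU : IsOpen U) {N : ℕ} (hχ : ContDiff ℝ (N + 1 : ℕ) χ) (hS : ContDiff ℝ (N + 1 : ℕ) S)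
    (hf : ContDiffOn ℝ N f U) {α : ℝ≥0} (hα : (α : ℝ) ≤ 1) {x : E} (hx : x ∈ U)
    (hh : ∃ s ∈ 𝓝 x, s ⊆ U ∧ ∃ C : ℝ≥0, HolderOnWith C α (iteratedFDeriv ℝ N f) s) :
    ∃ s ∈ 𝓝 x, s ⊆ U ∧
      ∃ C : ℝ≥0, HolderOnWith C α (iteratedFDeriv ℝ N fun y => χ y • f y + S y) s := by
  obtain ⟨s, hs, hsU, C, hC⟩ := hh
  set R := fun y => (iteratedFDeriv ℝ N (fun z => χ z • f z) y - χ y • iteratedFDeriv ℝ N f y) +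
    iteratedFDeriv ℝ N S y
  have hR : ContDiffAt ℝ 1 R x := by
    refine ContDiffAt.add ?_ (hS.contDiffAt.iteratedFDeriv_right (by norm_cast; omega))
    exact_mod_cast contDiffAt_iteratedFDeriv_smul_sub hU hχ hf N 0 (by omega) x hx
  obtain ⟨L, t, ht, hL⟩ := hR.exists_lipschitzOnWith
  obtain ⟨L', t', ht', hL'⟩ := (hχ.contDiffAt (x := x)).of_le
    (m := 1) (by norm_cast; omega) |>.exists_lipschitzOnWith
  have hb : ∀ᶠ y in 𝓝 x, ‖iteratedFDeriv ℝ N f y‖ < ‖iteratedFDeriv ℝ N f x‖ + 1 := by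
    have : ContinuousAt (iteratedFDeriv ℝ N f) x :=
      ((hf.contDiffAt (hU.mem_nhds hx)).iteratedFDeriv_right (m := 0) (by simp)).continuousAt
    exact this.norm.eventually_lt_const (by linarith)
  have ha : ∀ᶠ y in 𝓝 x, ‖χ y‖ < ‖χ x‖ + 1 :=
    hχ.continuous.norm.continuousAt.eventually_lt_const (by linarith)
  refine ⟨(s ∩ t ∩ t') ∩ ({y | ‖iteratedFDeriv ℝ N f y‖ < ‖iteratedFDeriv ℝ N f x‖ + 1} ∩
    {y | ‖χ y‖ < ‖χ x‖ + 1} ∩ Metric.ball x (1 / 2)),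
    inter_mem (inter_mem (inter_mem hs ht) ht')
      (inter_mem (inter_mem hb ha) (Metric.ball_mem_nhds x (by norm_num))),
    fun y hy => hsU hy.1.1.1,
    (‖χ x‖₊ + 1) * C + L' * (‖iteratedFDeriv ℝ N f x‖₊ + 1) + L,
    holderOnWith_of_dist_le ?_⟩
  rintro y ⟨⟨⟨hys, hyt⟩, hyt'⟩, ⟨hyb, hya⟩, hyx⟩ z ⟨⟨⟨hzs, hzt⟩, hzt'⟩, ⟨hzb, hza⟩, hzx⟩
  have hdec : ∀ w ∈ U, iteratedFDeriv ℝ N (fun y => χ y • f y + S y) w =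
      χ w • iteratedFDeriv ℝ N f w + R w := by
    intro w hw
    have h1 : ContDiffAt ℝ N (fun y => χ y • f y) w :=
      (hχ.contDiffAt.of_le (by norm_cast; omega)).smul (hf.contDiffAt (hU.mem_nhds hw))
    have h2 : ContDiffAt ℝ N S w := hS.contDiffAt.of_le (by norm_cast; omega)
    have := iteratedFDeriv_add_apply h1 h2
    rw [show (fun y => χ y • f y + S y) = (fun y => χ y • f y) + S from rfl, this]
    simp only [R]
    abel
  rw [hdec y (hsU hys), hdec z (hsU hzs)]
  have hd1 : dist y z ≤ 1 := by
    have := dist_triangle_right y z x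
    rw [Metric.mem_ball] at hyx hzx
    linarith
  set d := dist y z ^ (α : ℝ)
  have hdd : dist y z ≤ d := by
    have := Real.rpow_le_rpow_of_exponent_ge' (dist_nonneg (x := y) (y := z)) hd1
      α.coe_nonneg hα
    simpa using this
  have hd0 : 0 ≤ d := by positivity
  have e1 : dist (χ y • iteratedFDeriv ℝ N f y) (χ z • iteratedFDeriv ℝ N f z) ≤
      (‖χ x‖ + 1) * (C * d) + L' * d * (‖iteratedFDeriv ℝ N f x‖ + 1) := by
    have h1 := hC.dist_le hys hzs
    have h2 := hL'.dist_le_mul y hyt' z hzt'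
    rw [dist_eq_norm] at h1 h2 ⊢
    have e : χ y • iteratedFDeriv ℝ N f y - χ z • iteratedFDeriv ℝ N f z =
        χ y • (iteratedFDeriv ℝ N f y - iteratedFDeriv ℝ N f z) +
        (χ y - χ z) • iteratedFDeriv ℝ N f z := by
      rw [smul_sub, sub_smul]; abel
    rw [e]
    refine (norm_add_le _ _).trans ?_
    rw [norm_smul, norm_smul]
    have hya : ‖χ y‖ ≤ ‖χ x‖ + 1 := le_of_lt hya
    have hzb : ‖iteratedFDeriv ℝ N f z‖ ≤ ‖iteratedFDeriv ℝ N f x‖ + 1 := le_of_lt hzb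
    gcongr
    exact h2.trans (by gcongr)
  have e2 : dist (R y) (R z) ≤ L * d :=
    (hL.dist_le_mul y hyt z hzt).trans (by gcongr)
  refine (dist_add_add_le _ _ _ _).trans ((add_le_add e1 e2).trans (le_of_eq ?_))
  push_cast
  ring

end Holder

section Localization

variable {E : Type*} [NormedAddCommGroup E] [NormedSpace ℝ E]

theorem fderiv_mul_eventuallyEq {χ g : E → ℝ} {x : E} (hχ : ContDiffAt ℝ 2 χ x)
    (hg : ContDiffAt ℝ 2 g x) :
    fderiv ℝ (fun y => χ y * g y) =ᶠ[𝓝 x] fun y => χ y • fderiv ℝ g y + g y • fderiv ℝ χ y := by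
  filter_upwards [hχ.eventually (by simp), hg.eventually (by simp)] with y h1 h2
  exact fderiv_fun_mul (h1.differentiableAt two_ne_zero) (h2.differentiableAt two_ne_zero)

theorem norm_fderiv_mul_le {χ g : E → ℝ} {x : E} (hχ : ContDiffAt ℝ 2 χ x)
    (hg : ContDiffAt ℝ 2 g x) :
    ‖fderiv ℝ (fun y => χ y * g y) x‖ ≤
      ‖χ x‖ * ‖fderiv ℝ g x‖ + ‖g x‖ * ‖fderiv ℝ χ x‖ := by
  rw [(fderiv_mul_eventuallyEq hχ hg).self_of_nhds]
  exact (norm_add_le _ _).trans (by rw [norm_smul, norm_smul])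

theorem norm_fderiv_fderiv_mul_le {χ g : E → ℝ} {x : E} (hχ : ContDiffAt ℝ 2 χ x)
    (hg : ContDiffAt ℝ 2 g x) :
    ‖fderiv ℝ (fderiv ℝ fun y => χ y * g y) x‖ ≤
      ‖χ x‖ * ‖fderiv ℝ (fderiv ℝ g) x‖ + 2 * ‖fderiv ℝ χ x‖ * ‖fderiv ℝ g x‖ +
        ‖g x‖ * ‖fderiv ℝ (fderiv ℝ χ) x‖ := by
  rw [(fderiv_mul_eventuallyEq hχ hg).fderiv_eq]
  have h := ((hχ.differentiableAt two_ne_zero).hasFDerivAt.fun_smul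
    hg.differentiableAt_fderiv.hasFDerivAt).fun_add
    ((hg.differentiableAt two_ne_zero).hasFDerivAt.fun_smul
    hχ.differentiableAt_fderiv.hasFDerivAt)
  rw [h.fderiv]
  have e1 := norm_add_le (χ x • fderiv ℝ (fderiv ℝ g) x + (fderiv ℝ χ x).smulRight (fderiv ℝ g x))
    (g x • fderiv ℝ (fderiv ℝ χ) x + (fderiv ℝ g x).smulRight (fderiv ℝ χ x))
  have e2 := norm_add_le (χ x • fderiv ℝ (fderiv ℝ g) x)
    ((fderiv ℝ χ x).smulRight (fderiv ℝ g x))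
  have e3 := norm_add_le (g x • fderiv ℝ (fderiv ℝ χ) x)
    ((fderiv ℝ g x).smulRight (fderiv ℝ χ x))
  rw [ContinuousLinearMap.norm_smulRight_apply] at e2 e3
  have e4 := (fderiv ℝ (fderiv ℝ g) x).opNorm_smul_le (χ x)
  have e5 := (fderiv ℝ (fderiv ℝ χ) x).opNorm_smul_le (g x)
  linarith

theorem HasCompactSupport.exists_norm_fderiv_le {F : Type*} [NormedAddCommGroup F]
    [NormedSpace ℝ F] {b : E → F} (hs : HasCompactSupport b) (hb : ContDiff ℝ 1 b) :
    ∃ B, ∀ x, ‖fderiv ℝ b x‖ ≤ B :=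
  (hs.fderiv ℝ).exists_bound_of_continuous (hb.continuous_fderiv one_ne_zero)

/-- Cut-off functions with derivative bounds scaling like the inverse radius. -/
theorem exists_cutoff [FiniteDimensional ℝ E] : ∃ B₁ B₂ : ℝ, 0 ≤ B₁ ∧ 0 ≤ B₂ ∧
    ∀ (x₀ : E) (δ : ℝ), 0 < δ → ∃ χ : E → ℝ, (∀ m : ℕ, ContDiff ℝ m χ) ∧ (∀ x, ‖χ x‖ ≤ 1) ∧
      (∀ x, ‖x - x₀‖ ≤ δ → χ x = 1) ∧ (∀ x, 2 * δ ≤ ‖x - x₀‖ → χ x = 0) ∧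
      (∀ x, ‖fderiv ℝ χ x‖ ≤ B₁ / δ) ∧ ∀ x, ‖fderiv ℝ (fderiv ℝ χ) x‖ ≤ B₂ / δ ^ 2 := by
  obtain ⟨b, hbi, hbo⟩ : ∃ b : ContDiffBump (0 : E), b.rIn = 1 ∧ b.rOut = 2 :=
    ⟨⟨1, 2, one_pos, one_lt_two⟩, rfl, rfl⟩
  have hb : ∀ m : ℕ, ContDiff ℝ m b := fun m => b.contDiff
  have hb2 : ContDiff ℝ 2 b := hb 2
  have hb3 : ContDiff ℝ 1 (fderiv ℝ b) := hb2.fderiv_right (m := 1) (by norm_num)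
  have hs : HasCompactSupport (fderiv ℝ b) := b.hasCompactSupport.fderiv ℝ
  obtain ⟨B₁, hB₁⟩ := b.hasCompactSupport.exists_norm_fderiv_le (hb 1)
  obtain ⟨B₂, hB₂⟩ := hs.exists_norm_fderiv_le hb3
  refine ⟨B₁, B₂, (norm_nonneg (fderiv ℝ b 0)).trans (hB₁ 0),
    (norm_nonneg (fderiv ℝ (fderiv ℝ b) 0)).trans (hB₂ 0), ?_⟩
  intro x₀ δ hδ
  have hnorm : ∀ x, ‖δ⁻¹ • (x - x₀)‖ = ‖x - x₀‖ / δ := fun x => by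
    rw [norm_smul, norm_inv, Real.norm_of_nonneg hδ.le, inv_mul_eq_div]
  have hin : ∀ x, HasFDerivAt (fun x : E => δ⁻¹ • (x - x₀))
      (δ⁻¹ • ContinuousLinearMap.id ℝ E) x := fun x =>
    ((hasFDerivAt_id x).sub_const x₀).const_smul δ⁻¹
  have h1 : ∀ x, HasFDerivAt (fun x => b (δ⁻¹ • (x - x₀)))
      (δ⁻¹ • fderiv ℝ b (δ⁻¹ • (x - x₀))) x := fun x => by
    refine (((hb2.differentiable two_ne_zero) _).hasFDerivAt.comp x (hin x)).congr_fderiv ?_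
    ext v; simp
  have h2 : ∀ x, HasFDerivAt (fun x => δ⁻¹ • fderiv ℝ b (δ⁻¹ • (x - x₀)))
      (δ⁻¹ • δ⁻¹ • fderiv ℝ (fderiv ℝ b) (δ⁻¹ • (x - x₀))) x := fun x => by
    refine ((hb2.contDiffAt.differentiableAt_fderiv.hasFDerivAt.comp x
      (hin x)).const_smul δ⁻¹).congr_fderiv ?_
    ext v w; simp
  have h1' : fderiv ℝ (fun x => b (δ⁻¹ • (x - x₀))) =
      fun x => δ⁻¹ • fderiv ℝ b (δ⁻¹ • (x - x₀)) := funext fun x => (h1 x).fderiv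
  refine ⟨fun x => b (δ⁻¹ • (x - x₀)), fun m => (hb m).comp
    ((contDiff_id.sub contDiff_const).const_smul δ⁻¹), fun x => ?_, fun x hx => ?_,
    fun x hx => ?_, fun x => ?_, fun x => ?_⟩
  · rw [Real.norm_of_nonneg b.nonneg]
    exact b.le_one
  · refine b.one_of_mem_closedBall ?_
    rw [mem_closedBall_zero_iff, hnorm, div_le_iff₀ hδ]
    simpa [hbi] using hx
  · refine b.zero_of_le_dist ?_
    rw [dist_zero_right, hnorm, le_div_iff₀ hδ, hbo]
    exact hx
  · rw [h1', norm_smul, norm_inv, Real.norm_of_nonneg hδ.le, inv_mul_eq_div]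
    gcongr
    exact hB₁ _
  · rw [h1', (h2 x).fderiv]
    have e1 := (δ⁻¹ • fderiv ℝ (fderiv ℝ b) (δ⁻¹ • (x - x₀))).opNorm_smul_le δ⁻¹
    have e2 := (fderiv ℝ (fderiv ℝ b) (δ⁻¹ • (x - x₀))).opNorm_smul_le δ⁻¹
    rw [norm_inv, Real.norm_of_nonneg hδ.le] at e1 e2
    calc _ ≤ δ⁻¹ * (δ⁻¹ * B₂) := e1.trans (by gcongr; exact e2.trans (by gcongr; exact hB₂ _))
      _ = B₂ / δ ^ 2 := by field_simp

theorem norm_le_of_fderiv_fderiv_le {F : Type*} [NormedAddCommGroup F] [NormedSpace ℝ F]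
    {g : E → F} {x₀ : E} {r M : ℝ}
    (hg : ∀ x ∈ Metric.closedBall x₀ r, ContDiffAt ℝ 2 g x)
    (hM : ∀ x ∈ Metric.closedBall x₀ r, ‖fderiv ℝ (fderiv ℝ g) x‖ ≤ M)
    (h0 : g x₀ = 0) (h1 : fderiv ℝ g x₀ = 0) {x : E} (hx : x ∈ Metric.closedBall x₀ r) :
    ‖fderiv ℝ g x‖ ≤ M * ‖x - x₀‖ ∧ ‖g x‖ ≤ M * ‖x - x₀‖ ^ 2 := by
  have hsub : ∀ y ∈ Metric.closedBall x₀ r, Metric.closedBall x₀ ‖y - x₀‖ ⊆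
      Metric.closedBall x₀ r := fun y hy =>
    Metric.closedBall_subset_closedBall (by simpa [dist_eq_norm] using hy)
  have hmem : ∀ y : E, y ∈ Metric.closedBall x₀ ‖y - x₀‖ := fun y => by simp [dist_eq_norm]
  have hd : ∀ y ∈ Metric.closedBall x₀ r, ‖fderiv ℝ g y‖ ≤ M * ‖y - x₀‖ := by
    intro y hy
    have := (convex_closedBall x₀ ‖y - x₀‖).norm_image_sub_le_of_norm_fderiv_le (𝕜 := ℝ)
      (f := fderiv ℝ g) (C := M)
      (fun z hz => (hg z (hsub y hy hz)).differentiableAt_fderiv)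
      (fun z hz => hM z (hsub y hy hz)) (Metric.mem_closedBall_self (norm_nonneg _)) (hmem y)
    simpa [h1] using this
  refine ⟨hd x hx, ?_⟩
  have hM0 : 0 ≤ M := (norm_nonneg (fderiv ℝ (fderiv ℝ g) x)).trans (hM x hx)
  have := (convex_closedBall x₀ ‖x - x₀‖).norm_image_sub_le_of_norm_fderiv_le (𝕜 := ℝ)
    (f := g) (C := M * ‖x - x₀‖)
    (fun z hz => (hg z (hsub x hx hz)).differentiableAt two_ne_zero)
    (fun z hz => (hd z (hsub x hx hz)).trans (by
      rw [Metric.mem_closedBall, dist_eq_norm] at hz; gcongr))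
    (Metric.mem_closedBall_self (norm_nonneg _)) (hmem x)
  rw [h0, sub_zero] at this
  linarith [this]

end Localization

section Truncation

variable {E : Type*} [NormedAddCommGroup E] [NormedSpace ℝ E]

/-- The remainder of the first order Taylor expansion of `f` at `x₀`. -/
def taylorRem (f : E → ℝ) (x₀ x : E) : ℝ := f x - f x₀ - fderiv ℝ f x₀ (x - x₀)

theorem fderiv_taylorRem {f : E → ℝ} {x₀ x : E} (hf : DifferentiableAt ℝ f x) :
    fderiv ℝ (taylorRem f x₀) x = fderiv ℝ f x - fderiv ℝ f x₀ := by
  have h := (hf.hasFDerivAt.sub_const (f x₀)).fun_sub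
    ((fderiv ℝ f x₀).hasFDerivAt.comp x ((hasFDerivAt_id x).sub_const x₀))
  exact h.fderiv

theorem fderiv_fderiv_taylorRem {f : E → ℝ} {x₀ x : E} (hf : ContDiffAt ℝ 2 f x) :
    fderiv ℝ (fderiv ℝ (taylorRem f x₀)) x = fderiv ℝ (fderiv ℝ f) x := by
  have h : fderiv ℝ (taylorRem f x₀) =ᶠ[𝓝 x] fun y => fderiv ℝ f y - fderiv ℝ f x₀ := by
    filter_upwards [hf.eventually (by simp)] with y hy
    exact fderiv_taylorRem (hy.differentiableAt two_ne_zero)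
  rw [h.fderiv_eq, fderiv_sub_const]

theorem ContDiffAt.taylorRem {f : E → ℝ} {x₀ x : E} {m : WithTop ℕ∞} (hf : ContDiffAt ℝ m f x) :
    ContDiffAt ℝ m (taylorRem f x₀) x :=
  (hf.sub contDiffAt_const).sub
    ((fderiv ℝ f x₀).contDiff.contDiffAt.comp x (contDiffAt_id.sub contDiffAt_const))

theorem IsCompact.exists_norm_fderiv_le {F : Type*} [NormedAddCommGroup F] [NormedSpace ℝ F]
    {g : E → F} {K : Set E} (hK : IsCompact K) (hg : ∀ x ∈ K, ContDiffAt ℝ 1 g x) :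
    ∃ M, ∀ x ∈ K, ‖fderiv ℝ g x‖ ≤ M :=
  hK.exists_bound_of_continuousOn fun x hx =>
    ((hg x hx).fderiv_right (m := 0) (by norm_num)).continuousAt.continuousWithinAt

/-- A `C⁴` function, truncated to the `2δ`-ball after removing its first order Taylor polynomial,
has gradient of order `δ` and bounded Hessian. -/
theorem exists_truncation [FiniteDimensional ℝ E] {f : E → ℝ} {U : Set E} (hU : IsOpen U)
    (hf : ContDiffOn ℝ 4 f U) {x₀ : E} (hx₀ : x₀ ∈ U) :
    ∃ M r : ℝ, 0 ≤ M ∧ 0 < r ∧ Metric.closedBall x₀ r ⊆ U ∧ ∀ δ : ℝ, 0 < δ → 2 * δ < r →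
      ∃ χ : E → ℝ, (∀ m : ℕ, ContDiff ℝ m χ) ∧ (∀ x, ‖x - x₀‖ ≤ δ → χ x = 1) ∧
        (∀ x, 2 * δ ≤ ‖x - x₀‖ → χ x = 0) ∧
        ContDiff ℝ 4 (fun x => χ x * taylorRem f x₀ x) ∧
        (∀ x, ‖fderiv ℝ (fun x => χ x * taylorRem f x₀ x) x‖ ≤ M * δ) ∧
        (∀ x, ‖fderiv ℝ (fderiv ℝ fun x => χ x * taylorRem f x₀ x) x‖ ≤ M) ∧
        ∀ x, 2 * δ < ‖x - x₀‖ → fderiv ℝ (fderiv ℝ fun x => χ x * taylorRem f x₀ x) x = 0 := by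
  obtain ⟨r, hr, hrU⟩ := Metric.nhds_basis_closedBall.mem_iff.1 (hU.mem_nhds hx₀)
  have hat : ∀ x ∈ U, ContDiffAt ℝ 4 f x := fun x hx => hf.contDiffAt (hU.mem_nhds hx)
  have hat2 : ∀ x ∈ U, ContDiffAt ℝ 2 f x := fun x hx => (hat x hx).of_le (by norm_num)
  obtain ⟨M, hM⟩ := (isCompact_closedBall x₀ r).exists_norm_fderiv_le
    fun x hx => (hat2 x (hrU hx)).fderiv_right (m := 1) (by norm_num)
  have hM0 : 0 ≤ M := (norm_nonneg (fderiv ℝ (fderiv ℝ f) x₀)).trans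
    (hM x₀ (Metric.mem_closedBall_self hr.le))
  obtain ⟨B₁, B₂, hB₁, hB₂, hcut⟩ := exists_cutoff (E := E)
  refine ⟨M * (2 + 4 * B₁ + 4 * B₂), r, by positivity, hr, hrU, fun δ hδ hδr => ?_⟩
  obtain ⟨χ, hχ, hχ1, hχin, hχout, hDχ, hDDχ⟩ := hcut x₀ δ hδ
  have hg : ∀ x ∈ Metric.closedBall x₀ r, ContDiffAt ℝ 2 (taylorRem f x₀) x := fun x hx =>
    (hat2 x (hrU hx)).taylorRem
  have hbd : ∀ x ∈ Metric.closedBall x₀ r, ‖fderiv ℝ (taylorRem f x₀) x‖ ≤ M * ‖x - x₀‖ ∧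
      ‖taylorRem f x₀ x‖ ≤ M * ‖x - x₀‖ ^ 2 := fun x hx => by
    refine norm_le_of_fderiv_fderiv_le hg (fun x hx => ?_) (by simp [taylorRem]) ?_ hx
    · rw [fderiv_fderiv_taylorRem (hat2 x (hrU hx))]
      exact hM x hx
    · rw [fderiv_taylorRem ((hat2 x₀ hx₀).differentiableAt two_ne_zero), sub_self]
  have hzero : ∀ x, 2 * δ < ‖x - x₀‖ → (fun x => χ x * taylorRem f x₀ x) =ᶠ[𝓝 x] 0 := by
    intro x hx
    have : ∀ᶠ y in 𝓝 x, 2 * δ < ‖y - x₀‖ :=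
      ((continuous_id.sub continuous_const).norm.continuousAt).eventually_const_lt hx
    filter_upwards [this] with y hy
    simp [hχout y hy.le]
  have hχ2 : ∀ x, ContDiffAt ℝ 2 χ x := fun x => (hχ 2).contDiffAt
  have hmem : ∀ x, ‖x - x₀‖ ≤ 2 * δ → x ∈ Metric.closedBall x₀ r := fun x hx => by
    rw [Metric.mem_closedBall, dist_eq_norm]; linarith
  refine ⟨χ, hχ, hχin, hχout, contDiff_iff_contDiffAt.2 fun x => ?_, fun x => ?_, fun x => ?_,
    fun x hx => ?_⟩
  · rcases lt_or_ge (2 * δ) ‖x - x₀‖ with hx | hx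
    · exact contDiffAt_const.congr_of_eventuallyEq (hzero x hx)
    · exact (hχ 4).contDiffAt.mul (hat x (hrU (hmem x hx))).taylorRem
  · rcases lt_or_ge (2 * δ) ‖x - x₀‖ with hx | hx
    · rw [(hzero x hx).fderiv_eq]
      simp only [Pi.zero_def, fderiv_fun_const, Pi.zero_apply, norm_zero]
      positivity
    · obtain ⟨h1, h2⟩ := hbd x (hmem x hx)
      calc _ ≤ ‖χ x‖ * ‖fderiv ℝ (taylorRem f x₀) x‖ + ‖taylorRem f x₀ x‖ * ‖fderiv ℝ χ x‖ :=
            norm_fderiv_mul_le (hχ2 x) (hg x (hmem x hx))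
        _ ≤ 1 * (M * (2 * δ)) + M * (2 * δ) ^ 2 * (B₁ / δ) := by
            gcongr
            · exact hχ1 x
            · exact h1.trans (by gcongr)
            · exact h2.trans (by gcongr)
            · exact hDχ x
        _ = M * (2 + 4 * B₁) * δ := by field_simp; ring
        _ ≤ M * (2 + 4 * B₁ + 4 * B₂) * δ := by nlinarith [mul_nonneg (mul_nonneg hM0 hB₂) hδ.le]
  · rcases lt_or_ge (2 * δ) ‖x - x₀‖ with hx | hx
    · rw [(hzero x hx).fderiv.fderiv_eq]
      simp only [Pi.zero_def, fderiv_fun_const, Pi.zero_apply]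
      rw [ContinuousLinearMap.opNorm_zero]
      positivity
    · obtain ⟨h1, h2⟩ := hbd x (hmem x hx)
      have h3 := hM x (hmem x hx)
      rw [← fderiv_fderiv_taylorRem (x₀ := x₀) (hat2 x (hrU (hmem x hx)))] at h3
      refine (norm_fderiv_fderiv_mul_le (hχ2 x) (hg x (hmem x hx))).trans ?_
      calc _ ≤ 1 * M + 2 * (B₁ / δ) * (M * (2 * δ)) + M * (2 * δ) ^ 2 * (B₂ / δ ^ 2) := by
            gcongr
            · exact hχ1 x
            · exact hDχ x
            · exact h1.trans (by gcongr)
            · exact h2.trans (by gcongr)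
            · exact hDDχ x
        _ = M * (1 + 4 * B₁ + 4 * B₂) := by field_simp; ring
        _ ≤ M * (2 + 4 * B₁ + 4 * B₂) := by gcongr; norm_num
  · rw [(hzero x hx).fderiv.fderiv_eq]
    simp only [Pi.zero_def, fderiv_fun_const]

end Truncation

section LocalizedTestFunction

theorem fderiv_add_const_mul {E : Type*} [NormedAddCommGroup E] [NormedSpace ℝ E] {k b : E → ℝ}
    (hk : ContDiff ℝ 2 k) (hb : ContDiff ℝ 2 b) (K : ℝ) :
    fderiv ℝ (fun x => k x + K * b x) = fun x => fderiv ℝ k x + K • fderiv ℝ b x :=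
  funext fun x => ((hk.differentiable two_ne_zero x).hasFDerivAt.fun_add
    ((hb.differentiable two_ne_zero x).hasFDerivAt.const_mul K)).fderiv

theorem fderiv_fderiv_add_const_mul {E : Type*} [NormedAddCommGroup E] [NormedSpace ℝ E]
    {k b : E → ℝ} {x : E} (hk : ContDiffAt ℝ 2 k x) (hb : ContDiffAt ℝ 2 b x) (K : ℝ) :
    fderiv ℝ (fderiv ℝ fun x => k x + K * b x) x =
      fderiv ℝ (fderiv ℝ k) x + K • fderiv ℝ (fderiv ℝ b) x := by
  have h : fderiv ℝ (fun x => k x + K * b x) =ᶠ[𝓝 x] fun y => fderiv ℝ k y + K • fderiv ℝ b y := by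
    filter_upwards [hk.eventually (by simp), hb.eventually (by simp)] with y h1 h2
    exact ((h1.differentiableAt two_ne_zero).hasFDerivAt.fun_add
      ((h2.differentiableAt two_ne_zero).hasFDerivAt.const_mul K)).fderiv
  rw [h.fderiv_eq]
  exact (hk.differentiableAt_fderiv.hasFDerivAt.fun_add
    (hb.differentiableAt_fderiv.hasFDerivAt.fun_const_smul K)).fderiv

variable {n : ℕ}

theorem MemTestClass.of_bounded_fderiv {h : (Fin n → ℝ) → ℝ} (hs : ContDiff ℝ 4 h)
    (hh : ∃ α : ℝ≥0, 0 < α ∧ (α : ℝ) ≤ 1 ∧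
      ∀ x ∈ posOrth n, ∃ s ∈ 𝓝 x, s ⊆ posOrth n ∧
        ∃ C : ℝ≥0, HolderOnWith C α (iteratedFDeriv ℝ 4 h) s)
    {C₁ C₂ : ℝ} (h1 : ∀ x, ‖fderiv ℝ h x‖ ≤ C₁) (h2 : ∀ x, ‖fderiv ℝ (fderiv ℝ h) x‖ ≤ C₂) :
    MemTestClass n h := by
  refine ⟨hs.contDiffOn, hh, |h 0| + C₁ + C₂, 1, fun x _ k hk => ?_⟩
  have hC1 : 0 ≤ C₁ := (norm_nonneg (fderiv ℝ h 0)).trans (h1 0)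
  have hC2 : 0 ≤ C₂ := (norm_nonneg (fderiv ℝ (fderiv ℝ h) 0)).trans (h2 0)
  have hx := norm_nonneg x
  have h0 := abs_nonneg (h 0)
  rw [Real.rpow_one]
  interval_cases k
  · rw [norm_iteratedFDeriv_zero]
    have h3 := convex_univ.norm_image_sub_le_of_norm_fderiv_le (𝕜 := ℝ) (f := h) (C := C₁)
      (fun z _ => hs.differentiable four_ne_zero z) (fun z _ => h1 z) (mem_univ 0) (mem_univ x)
    rw [sub_zero] at h3
    have h4 := norm_add_le (h x - h 0) (h 0)
    rw [sub_add_cancel, Real.norm_eq_abs (h 0)] at h4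
    nlinarith
  · rw [norm_iteratedFDeriv_one]
    nlinarith [h1 x]
  · rw [← norm_iteratedFDeriv_fderiv, norm_iteratedFDeriv_one]
    have h3 := h2 x
    nlinarith

/-- A convex test function can be replaced, without changing it near `x₀` except for an affine part
and a multiple of the barrier, by a convex test function with gradient of order `δ` and Hessian
of order `δ / (δ + |x - x₀|)`. -/
theorem exists_localization {f : (Fin n → ℝ) → ℝ} (hf : MemTestClass n f)
    (hconv : ConvexOn ℝ (posOrth n) f) {x₀ : Fin n → ℝ} (hx₀ : x₀ ∈ posOrth n) :
    ∃ C K δ₁ : ℝ, 0 < C ∧ 0 < δ₁ ∧ ∀ δ, 0 < δ → δ < δ₁ → ∃ h : (Fin n → ℝ) → ℝ,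
      MemTestClass n h ∧ ContDiff ℝ 4 h ∧ (∀ x v, 0 ≤ fderiv ℝ (fderiv ℝ h) x v v) ∧
      (∀ᶠ x in 𝓝 x₀, h x = taylorRem f x₀ x + K * barrier δ x₀ x) ∧
      (∀ x, ‖fderiv ℝ h x‖ ≤ C * δ) ∧
      ∀ x, ‖fderiv ℝ (fderiv ℝ h) x‖ * (δ + ‖x - x₀‖) ≤ C * δ := by
  obtain ⟨M, r, hM, hr, hrU, htr⟩ := exists_truncation (isOpen_posOrth n) hf.smooth hx₀
  obtain ⟨C, c, hC, hc, hbar⟩ := exists_barrier_bounds n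
  have hK : 0 ≤ M / c := by positivity
  refine ⟨3 * M + M / c * C + 1, M / c, r / 2, by positivity, by positivity, fun δ hδ hδr => ?_⟩
  obtain ⟨χ, hχ, hχin, hχout, hk4, hk1, hk2, hk0⟩ := htr δ hδ (by linarith)
  obtain ⟨hb1, hb2, -, hb3⟩ := hbar x₀ δ hδ
  set k := fun x => χ x * taylorRem f x₀ x with hk
  have hk' : ContDiff ℝ 2 k := hk4.of_le (by norm_num)
  have hb4 : ∀ m : WithTop ℕ∞, ContDiff ℝ m (barrier δ x₀) := fun m => contDiff_barrier hδ x₀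
  have hD := fderiv_add_const_mul hk' (hb4 2) (M / c)
  have hDD := fun x => fderiv_fderiv_add_const_mul (x := x) hk'.contDiffAt (hb4 2).contDiffAt (M / c)
  have hbd1 : ∀ x, ‖fderiv ℝ (fun x => k x + M / c * barrier δ x₀ x) x‖ ≤
      (3 * M + M / c * C + 1) * δ := fun x => by
    rw [hD]
    have e1 := norm_add_le (fderiv ℝ k x) ((M / c) • fderiv ℝ (barrier δ x₀) x)
    rw [norm_smul, Real.norm_of_nonneg hK] at e1
    have e2 := mul_le_mul_of_nonneg_left (hb1 x) hK
    nlinarith [hk1 x, mul_nonneg hM hδ.le]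
  have hbd2 : ∀ x, ‖fderiv ℝ (fderiv ℝ fun x => k x + M / c * barrier δ x₀ x) x‖ *
      (δ + ‖x - x₀‖) ≤ (3 * M + M / c * C + 1) * δ := fun x => by
    rw [hDD]
    have e1 := (fderiv ℝ (fderiv ℝ k) x).opNorm_add_le
      ((M / c) • fderiv ℝ (fderiv ℝ (barrier δ x₀)) x)
    have e2 := (fderiv ℝ (fderiv ℝ (barrier δ x₀)) x).opNorm_smul_le (M / c)
    rw [Real.norm_of_nonneg hK] at e2
    have e3 : ‖fderiv ℝ (fderiv ℝ k) x‖ * (δ + ‖x - x₀‖) ≤ 3 * M * δ := by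
      rcases lt_or_ge (2 * δ) ‖x - x₀‖ with hx | hx
      · rw [hk0 x hx, ContinuousLinearMap.opNorm_zero, zero_mul]
        positivity
      · calc _ ≤ M * (δ + 2 * δ) := by
              gcongr
              exact hk2 x
          _ = 3 * M * δ := by ring
    have e4 := mul_le_mul_of_nonneg_left (hb2 x) hK
    have hpos : 0 ≤ δ + ‖x - x₀‖ := by positivity
    have e5 := mul_le_mul_of_nonneg_right (e1.trans (add_le_add_right e2 _)) hpos
    nlinarith
  refine ⟨fun x => k x + M / c * barrier δ x₀ x, ?_, hk4.add (contDiff_const.mul (hb4 4)),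
    fun x v => ?_, ?_, hbd1, hbd2⟩
  · refine MemTestClass.of_bounded_fderiv (C₂ := 3 * M + M / c * C + 1)
      (hk4.add (contDiff_const.mul (hb4 4))) ?_ hbd1 fun x => ?_
    · obtain ⟨α, hα, hα1, hh⟩ := hf.holder4
      refine ⟨α, hα, hα1, fun x hx => ?_⟩
      have heq : (fun x => k x + M / c * barrier δ x₀ x) = fun x => χ x • f x +
          (M / c * barrier δ x₀ x - χ x * (f x₀ + fderiv ℝ f x₀ (x - x₀))) := by
        ext1 x
        simp only [hk, taylorRem, smul_eq_mul]
        ring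
      rw [heq]
      exact exists_holderOnWith_iteratedFDeriv_smul_add (N := 4) (isOpen_posOrth n) (hχ 5)
        ((contDiff_const.mul (hb4 5)).sub ((hχ 5).mul (contDiff_const.add
          ((fderiv ℝ f x₀).contDiff.comp (contDiff_id.sub contDiff_const))))) hf.smooth hα1 hx
        (hh x hx)
    · refine le_of_mul_le_mul_right ((?_ : _ ≤ _).trans (hbd2 x)) hδ
      gcongr
      linarith [norm_nonneg (x - x₀)]
  · rw [hDD]
    simp only [_root_.add_apply, _root_.smul_apply, smul_eq_mul]
    rcases lt_or_ge ‖x - x₀‖ δ with hx | hx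
    · have hxU : x ∈ posOrth n := hrU (by
        rw [Metric.mem_closedBall, dist_eq_norm]; linarith)
      have heq : k =ᶠ[𝓝 x] taylorRem f x₀ := by
        have : ∀ᶠ y in 𝓝 x, ‖y - x₀‖ < δ :=
          ((continuous_id.sub continuous_const).norm.continuousAt).eventually_lt_const hx
        filter_upwards [this] with y hy
        simp [hk, hχin y hy.le]
      rw [heq.fderiv.fderiv_eq, fderiv_fderiv_taylorRem ((hf.smooth.contDiffAt
        ((isOpen_posOrth n).mem_nhds hxU)).of_le (by norm_num))]
      exact add_nonneg (hconv.fderiv_fderiv_nonneg (isOpen_posOrth n)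
        (hf.smooth.of_le (by norm_num)) hxU v)
        (mul_nonneg hK (fderiv_fderiv_barrier_nonneg hδ x₀ x v))
    · rcases lt_or_ge (2 * δ) ‖x - x₀‖ with hx2 | hx2
      · rw [hk0 x hx2]
        simpa using mul_nonneg hK (fderiv_fderiv_barrier_nonneg hδ x₀ x v)
      · have e1 := mul_le_mul_of_nonneg_left (hb3 x hx hx2 v) hK
        rw [← mul_assoc, div_mul_cancel₀ _ hc.ne'] at e1
        have e2 := (fderiv ℝ (fderiv ℝ k) x).le_opNorm₂ v v
        rw [Real.norm_eq_abs] at e2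
        have e3 := neg_abs_le (fderiv ℝ (fderiv ℝ k) x v v)
        have e4 : ‖fderiv ℝ (fderiv ℝ k) x‖ * ‖v‖ * ‖v‖ ≤ M * ‖v‖ * ‖v‖ := by
          gcongr
          exact hk2 x
        nlinarith
  · filter_upwards [Metric.closedBall_mem_nhds x₀ hδ] with x hx
    rw [Metric.mem_closedBall, dist_eq_norm] at hx
    simp [hk, hχin x hx]

end LocalizedTestFunction

section Diffusion

variable {n : ℕ}

theorem ContDiffAt.dmix {f : (Fin n → ℝ) → ℝ} {x : Fin n → ℝ} (hf : ContDiffAt ℝ 4 f x)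
    (v w : Fin n → ℝ) : ContDiffAt ℝ 2 (fun y => _root_.dmix f y v w) x :=
  ((((hf.fderiv_right (m := 3) (by norm_num)).clm_apply contDiffAt_const).fderiv_right
    (m := 2) (by norm_num)).clm_apply contDiffAt_const)

variable {T : ℝ} (Dk : DiffKernel n T)

theorem DiffKernel.contDiffAt_coeff {t : ℝ} (ht : t ∈ Icc (0 : ℝ) T) {x : Fin n → ℝ}
    (hx : x ∈ posOrth n) (i j : Fin n) :
    ContDiffAt ℝ 2 (fun y => (Dk.β y t * (Dk.β y t)ᵀ) i j / 2) x := by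
  simp only [Matrix.mul_apply, Matrix.transpose_apply]
  have h : ∀ i j, ContDiffAt ℝ 2 (fun y => Dk.β y t i j) x := fun i j =>
    (Dk.smooth t ht i j).contDiffAt ((isOpen_posOrth n).mem_nhds hx)
  exact (ContDiffAt.sum fun k _ => (h i k).mul (h j k)).div_const 2

theorem contDiffAt_Aop {t : ℝ} (ht : t ∈ Icc (0 : ℝ) T) {f : (Fin n → ℝ) → ℝ} {x : Fin n → ℝ}
    (hx : x ∈ posOrth n) (hf : ContDiffAt ℝ 4 f x) :
    ContDiffAt ℝ 2 (fun y => Aop Dk f y t) x :=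
  ContDiffAt.sum fun i _ => ContDiffAt.sum fun j _ =>
    (Dk.contDiffAt_coeff ht hx i j).mul (hf.dmix _ _)

theorem abs_dmix_le {f : (Fin n → ℝ) → ℝ} {x : Fin n → ℝ} (hf : ContDiffAt ℝ 2 f x)
    (v w : Fin n → ℝ) : |dmix f x v w| ≤ ‖fderiv ℝ (fderiv ℝ f) x‖ * ‖w‖ * ‖v‖ := by
  rw [dmix_eq hf.differentiableAt_fderiv]
  exact (fderiv ℝ (fderiv ℝ f) x).le_opNorm₂ w v

/-- A function whose Hessian vanishes to order four at `x₀` does not contribute to the second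
derivatives of `A f` at `x₀`. -/
theorem fderiv_fderiv_Aop_eq_zero {t : ℝ} (ht : t ∈ Icc (0 : ℝ) T) {b : (Fin n → ℝ) → ℝ}
    (hb : ContDiff ℝ 4 b) {x₀ : Fin n → ℝ} (hx₀ : x₀ ∈ posOrth n) {C : ℝ}
    (hC : ∀ x, ‖fderiv ℝ (fderiv ℝ b) x‖ ≤ C * ‖x - x₀‖ ^ 4) (v : Fin n → ℝ) :
    fderiv ℝ (fderiv ℝ fun y => Aop Dk b y t) x₀ v v = 0 := by
  set S := fun y => ∑ i, ∑ j, |(Dk.β y t * (Dk.β y t)ᵀ) i j / 2|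
  have hS : ContinuousAt S x₀ := tendsto_finsetSum _ fun i _ => tendsto_finsetSum _ fun j _ =>
    (Dk.contDiffAt_coeff ht hx₀ i j).continuousAt.abs
  refine fderiv_fderiv_apply_eq_zero_of_cubic (C := (S x₀ + 1) * |C|)
    (contDiffAt_Aop Dk ht hx₀ hb.contDiffAt) ?_ v
  filter_upwards [hS.eventually_lt_const (lt_add_one _), Metric.closedBall_mem_nhds x₀ one_pos]
    with y hy hy1
  rw [Metric.mem_closedBall, dist_eq_norm] at hy1
  have hS0 : 0 ≤ S y := Finset.sum_nonneg fun i _ => Finset.sum_nonneg fun j _ => abs_nonneg _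
  have h4 : ‖fderiv ℝ (fderiv ℝ b) y‖ ≤ |C| * ‖y - x₀‖ ^ 3 := by
    refine (hC y).trans ?_
    have h : ‖y - x₀‖ ^ 4 ≤ ‖y - x₀‖ ^ 3 :=
      pow_le_pow_of_le_one (norm_nonneg _) hy1 (by norm_num)
    exact mul_le_mul (le_abs_self C) h (by positivity) (abs_nonneg C)
  calc |Aop Dk b y t| ≤ ∑ i, ∑ j, |(Dk.β y t * (Dk.β y t)ᵀ) i j / 2| *
        ‖fderiv ℝ (fderiv ℝ b) y‖ := by
        refine (Finset.abs_sum_le_sum_abs _ _).trans (Finset.sum_le_sum fun i _ => ?_)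
        refine (Finset.abs_sum_le_sum_abs _ _).trans (Finset.sum_le_sum fun j _ => ?_)
        rw [abs_mul]
        gcongr
        refine (abs_dmix_le (hb.contDiffAt.of_le (by norm_num)) _ _).trans (le_of_eq ?_)
        simp [Pi.norm_single]
    _ = S y * ‖fderiv ℝ (fderiv ℝ b) y‖ := by simp only [S, Finset.sum_mul]
    _ ≤ (S x₀ + 1) * (|C| * ‖y - x₀‖ ^ 3) := by gcongr
    _ = (S x₀ + 1) * |C| * ‖y - x₀‖ ^ 3 := by ring

theorem dir2_Aop_eq_of_eventuallyEq {t : ℝ} (ht : t ∈ Icc (0 : ℝ) T)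
    {f h b : (Fin n → ℝ) → ℝ} {x₀ : Fin n → ℝ} (hx₀ : x₀ ∈ posOrth n)
    (hf : ContDiffAt ℝ 4 f x₀) (hb : ContDiff ℝ 4 b) {C K : ℝ}
    (hC : ∀ x, ‖fderiv ℝ (fderiv ℝ b) x‖ ≤ C * ‖x - x₀‖ ^ 4)
    (hh : ∀ᶠ x in 𝓝 x₀, h x = taylorRem f x₀ x + K * b x) (v : Fin n → ℝ) :
    dir2 (fun y => Aop Dk h y t) x₀ v = dir2 (fun y => Aop Dk f y t) x₀ v := by
  have hA : (fun y => Aop Dk h y t) =ᶠ[𝓝 x₀] fun y => Aop Dk f y t + K * Aop Dk b y t := by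
    filter_upwards [hh.eventually_nhds, hf.eventually (by simp)] with y hy hfy
    have hy' : h =ᶠ[𝓝 y] fun x => taylorRem f x₀ x + K * b x := hy
    have hf2 : ContDiffAt ℝ 2 f y := hfy.of_le (by norm_num)
    have hb2 : ContDiffAt ℝ 2 b y := hb.contDiffAt.of_le (by norm_num)
    have hd : ContDiffAt ℝ 2 h y := ((hf2.taylorRem).add
      (contDiffAt_const.mul hb2)).congr_of_eventuallyEq hy'
    have hDD : fderiv ℝ (fderiv ℝ h) y =
        fderiv ℝ (fderiv ℝ f) y + K • fderiv ℝ (fderiv ℝ b) y := by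
      rw [hy'.fderiv.fderiv_eq, fderiv_fderiv_add_const_mul hf2.taylorRem hb2,
        fderiv_fderiv_taylorRem hf2]
    simp only [Aop, dmix_eq hd.differentiableAt_fderiv, dmix_eq hf2.differentiableAt_fderiv,
      dmix_eq hb2.differentiableAt_fderiv, hDD, Finset.mul_sum, ← Finset.sum_add_distrib]
    refine Finset.sum_congr rfl fun i _ => Finset.sum_congr rfl fun j _ => ?_
    simp only [_root_.add_apply, _root_.smul_apply, smul_eq_mul]
    ring
  have hAf := contDiffAt_Aop Dk ht hx₀ hf
  have hAb := contDiffAt_Aop Dk ht hx₀ (hb.contDiffAt (x := x₀))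
  rw [dir2_eq hAf, dir2_eq ((hAf.add (contDiffAt_const.mul hAb)).congr_of_eventuallyEq hA),
    hA.fderiv.fderiv_eq, fderiv_fderiv_add_const_mul hAf hAb]
  simp only [_root_.add_apply, _root_.smul_apply, smul_eq_mul]
  rw [fderiv_fderiv_Aop_eq_zero Dk ht hb hx₀ hC, mul_zero, add_zero]

end Diffusion

section UniformDerivativeBounds

variable {E F : Type*} [NormedAddCommGroup E] [NormedSpace ℝ E]
  [NormedAddCommGroup F] [NormedSpace ℝ F]

/-- Interpolation: a bounded function whose Hessian has bounded oscillation has a bounded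
gradient. -/
theorem norm_fderiv_le_of_osc {ψ : E → F} {x : E} {ρ M C : ℝ} (hρ : 0 < ρ)
    (hψ : ∀ y ∈ Metric.closedBall x ρ, ContDiffAt ℝ 2 ψ y)
    (hM : ∀ y ∈ Metric.closedBall x ρ, ‖ψ y‖ ≤ M)
    (hC : ∀ y ∈ Metric.closedBall x ρ, ∀ z ∈ Metric.closedBall x ρ,
      ‖fderiv ℝ (fderiv ℝ ψ) y - fderiv ℝ (fderiv ℝ ψ) z‖ ≤ C) :
    ‖fderiv ℝ ψ x‖ ≤ M / ρ + C / 2 * ρ := by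
  have hp : ∀ y ∈ Metric.closedBall (0 : E) ρ, x + y ∈ Metric.closedBall x ρ := fun y hy => by
    simpa using hy
  have hm : ∀ y ∈ Metric.closedBall (0 : E) ρ, x - y ∈ Metric.closedBall x ρ := fun y hy => by
    simpa [dist_eq_norm] using hy
  have hM0 : 0 ≤ M := (norm_nonneg _).trans (hM x (Metric.mem_closedBall_self hρ.le))
  have hC0 : 0 ≤ C := (norm_nonneg (fderiv ℝ (fderiv ℝ ψ) x - fderiv ℝ (fderiv ℝ ψ) x)).trans
    (hC x (Metric.mem_closedBall_self hρ.le) x (Metric.mem_closedBall_self hρ.le))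
  set G : E → F := fun y => ψ (x + y) - ψ (x - y) - (2 : ℝ) • fderiv ℝ ψ x y with hG
  have hG2 : ∀ y ∈ Metric.closedBall (0 : E) ρ, ContDiffAt ℝ 2 G y := fun y hy =>
    (((hψ _ (hp y hy)).comp y (contDiffAt_const.add contDiffAt_id)).sub
      ((hψ _ (hm y hy)).comp y (contDiffAt_const.sub contDiffAt_id))).sub
      ((fderiv ℝ ψ x).contDiff.contDiffAt.const_smul _)
  have ha : ∀ y, HasFDerivAt (fun y : E => x + y) (ContinuousLinearMap.id ℝ E) y := fun y =>
    (hasFDerivAt_id y).const_add x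
  have hs : ∀ y, HasFDerivAt (fun y : E => x - y) (-ContinuousLinearMap.id ℝ E) y := fun y =>
    (hasFDerivAt_id y).const_sub x
  have hDG : ∀ y, ContDiffAt ℝ 2 ψ (x + y) → ContDiffAt ℝ 2 ψ (x - y) →
      fderiv ℝ G y = fderiv ℝ ψ (x + y) + fderiv ℝ ψ (x - y) - (2 : ℝ) • fderiv ℝ ψ x := by
    intro y h1 h2
    have := (((h1.differentiableAt two_ne_zero).hasFDerivAt.comp y (ha y)).fun_sub
      ((h2.differentiableAt two_ne_zero).hasFDerivAt.comp y (hs y))).fun_sub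
      ((fderiv ℝ ψ x).hasFDerivAt.fun_const_smul (2 : ℝ))
    refine this.fderiv.trans ?_
    ext v
    simp
  have hDDG : ∀ y ∈ Metric.closedBall (0 : E) ρ, fderiv ℝ (fderiv ℝ G) y =
      fderiv ℝ (fderiv ℝ ψ) (x + y) - fderiv ℝ (fderiv ℝ ψ) (x - y) := by
    intro y hy
    have h1 := hψ _ (hp y hy)
    have h2 := hψ _ (hm y hy)
    have hev : fderiv ℝ G =ᶠ[𝓝 y] fun y =>
        fderiv ℝ ψ (x + y) + fderiv ℝ ψ (x - y) - (2 : ℝ) • fderiv ℝ ψ x := by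
      filter_upwards [(ha y).continuousAt.eventually (h1.eventually (by simp)),
        (hs y).continuousAt.eventually (h2.eventually (by simp))] with w hw1 hw2
      exact hDG w hw1 hw2
    rw [hev.fderiv_eq]
    have := ((h1.differentiableAt_fderiv.hasFDerivAt.comp y (ha y)).fun_add
      (h2.differentiableAt_fderiv.hasFDerivAt.comp y (hs y))).sub_const ((2 : ℝ) • fderiv ℝ ψ x)
    refine this.fderiv.trans ?_
    ext v w
    simp [sub_eq_add_neg]
  have hG0 : fderiv ℝ G 0 = 0 := by
    have h := hψ x (Metric.mem_closedBall_self hρ.le)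
    rw [hDG 0 (by simpa using h) (by simpa using h), add_zero, sub_zero, two_smul, sub_self]
  refine ContinuousLinearMap.opNorm_le_of_unit_norm (by positivity) fun e he => ?_
  have hmem : ρ • e ∈ Metric.closedBall (0 : E) ρ := by
    simp [norm_smul, he, abs_of_pos hρ]
  have hb := (norm_le_of_fderiv_fderiv_le hG2 (fun y hy => by
    rw [hDDG y hy]; exact hC _ (hp y hy) _ (hm y hy)) (by simp [hG]) hG0 hmem).2
  have hid : (2 * ρ) • fderiv ℝ ψ x e = ψ (x + ρ • e) - ψ (x - ρ • e) - G (ρ • e) := by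
    simp [hG, mul_smul]
  have hn : ‖(2 * ρ) • fderiv ℝ ψ x e‖ ≤ M + M + C * ρ ^ 2 := by
    rw [hid]
    refine (norm_sub_le _ _).trans (add_le_add ((norm_sub_le _ _).trans
      (add_le_add (hM _ (hp _ hmem)) (hM _ (hm _ hmem)))) (hb.trans (le_of_eq ?_)))
    simp [norm_smul, he, abs_of_pos hρ]
  rw [norm_smul, Real.norm_of_nonneg (by positivity)] at hn
  have : ‖fderiv ℝ ψ x e‖ ≤ (M + M + C * ρ ^ 2) / (2 * ρ) := by
    rw [le_div_iff₀ (by positivity)]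
    linarith
  refine this.trans (le_of_eq ?_)
  field_simp
  ring

/-- A bounded function whose derivative oscillates boundedly has a bounded derivative. -/
theorem norm_fderiv_le_of_norm_sub_le {θ : E → F} {x : E} {ρ M C : ℝ} (hρ : 0 < ρ)
    (hθ : ∀ y ∈ Metric.closedBall x ρ, DifferentiableAt ℝ θ y)
    (hM : ∀ y ∈ Metric.closedBall x ρ, ‖θ y‖ ≤ M)
    (hC : ∀ y ∈ Metric.closedBall x ρ, ‖fderiv ℝ θ y - fderiv ℝ θ x‖ ≤ C) :
    ‖fderiv ℝ θ x‖ ≤ 2 * M / ρ + C := by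
  have hx := Metric.mem_closedBall_self (x := x) hρ.le
  have hM0 : 0 ≤ M := (norm_nonneg _).trans (hM x hx)
  have hC0 : 0 ≤ C := (norm_nonneg (fderiv ℝ θ x - fderiv ℝ θ x)).trans (hC x hx)
  refine ContinuousLinearMap.opNorm_le_of_unit_norm (by positivity) fun e he => ?_
  have hmem : x + ρ • e ∈ Metric.closedBall x ρ := by
    simp [norm_smul, he, abs_of_pos hρ]
  have h := (convex_closedBall x ρ).norm_image_sub_le_of_norm_fderiv_le' (𝕜 := ℝ) hθ hC hx hmem
  have hid : ρ • fderiv ℝ θ x e =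
      θ (x + ρ • e) - θ x - (θ (x + ρ • e) - θ x - fderiv ℝ θ x (x + ρ • e - x)) := by
    simp
  have hn : ‖ρ • fderiv ℝ θ x e‖ ≤ M + M + C * ρ := by
    rw [hid]
    refine (norm_sub_le _ _).trans (add_le_add ((norm_sub_le _ _).trans
      (add_le_add (hM _ hmem) (hM _ hx))) (h.trans (le_of_eq ?_)))
    simp [norm_smul, he, abs_of_pos hρ]
  rw [norm_smul, Real.norm_of_nonneg hρ.le] at hn
  have : ‖fderiv ℝ θ x e‖ ≤ (M + M + C * ρ) / ρ := by
    rw [le_div_iff₀ hρ]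
    linarith
  refine this.trans (le_of_eq ?_)
  field_simp
  ring

theorem norm_fderiv_fderiv_sub_le {ψ : E → F} (x y : E) :
    ‖fderiv ℝ (fderiv ℝ ψ) x - fderiv ℝ (fderiv ℝ ψ) y‖ ≤
      dist (iteratedFDeriv ℝ 2 ψ x) (iteratedFDeriv ℝ 2 ψ y) := by
  refine ContinuousLinearMap.opNorm_le_bound₂ _ dist_nonneg fun u w => ?_
  have h := (iteratedFDeriv ℝ 2 ψ x - iteratedFDeriv ℝ 2 ψ y).le_opNorm ![u, w]
  simpa [iteratedFDeriv_two_apply, Fin.prod_univ_two, dist_eq_norm, mul_assoc] using h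

end UniformDerivativeBounds

section JumpBounds

variable {n : ℕ} {T : ℝ}

/-- The jump map and its derivatives up to order two are bounded near every point, uniformly in the
mark `z`. -/
theorem JumpKernel.exists_uniform_bounds (K : JumpKernel n T) {t : ℝ} (ht : t ∈ Icc (0 : ℝ) T)
    {x₀ : Fin n → ℝ} (hx₀ : x₀ ∈ posOrth n) :
    ∃ r M : ℝ, 0 < r ∧ 0 ≤ M ∧ Metric.closedBall x₀ r ⊆ posOrth n ∧ ∀ z ∈ Icc (0 : ℝ) 1,
      ∀ y ∈ Metric.closedBall x₀ r, ‖K.φ y t z‖ ≤ M ∧ ‖fderiv ℝ (fun y => K.φ y t z) y‖ ≤ M ∧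
        ‖fderiv ℝ (fderiv ℝ fun y => K.φ y t z) y‖ ≤ M := by
  obtain ⟨α, -, -, hh⟩ := K.holder2
  obtain ⟨s, hs, hsU, C, hC⟩ := hh t ht x₀ hx₀
  obtain ⟨D, hD, hbound⟩ := K.bound
  obtain ⟨R', hR', hRs⟩ := Metric.nhds_basis_closedBall.mem_iff.1 hs
  set R := min R' (1 / 2) with hR_def
  have hR : 0 < R := lt_min hR' (by norm_num)
  have hsub : Metric.closedBall x₀ R ⊆ s :=
    (Metric.closedBall_subset_closedBall (min_le_left _ _)).trans hRs
  set M₀ := √(D * (‖x₀‖ + R) ^ 2)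
  have h0 : ∀ z ∈ Icc (0 : ℝ) 1, ∀ y ∈ Metric.closedBall x₀ R, ‖K.φ y t z‖ ≤ M₀ := by
    intro z hz y hy
    refine (pi_norm_le_iff_of_nonneg (Real.sqrt_nonneg _)).2 fun i => Real.abs_le_sqrt ?_
    refine (hbound y (hsU (hsub hy)) t ht z hz i).trans ?_
    have h1 : |y i| ≤ ‖x₀‖ + R := by
      refine (norm_le_pi_norm y i).trans ?_
      rw [Metric.mem_closedBall, dist_eq_norm] at hy
      have := norm_add_le x₀ (y - x₀)
      rw [add_sub_cancel] at this
      linarith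
    exact mul_le_mul_of_nonneg_left (sq_le_sq' (abs_le.1 h1).1 (abs_le.1 h1).2) hD.le
  have hC2 : ∀ z ∈ Icc (0 : ℝ) 1, ∀ y ∈ Metric.closedBall x₀ R, ContDiffAt ℝ 2
      (fun y => K.φ y t z) y := fun z hz y hy =>
    (K.smooth t ht z hz).contDiffAt ((isOpen_posOrth n).mem_nhds (hsU (hsub hy)))
  have hosc : ∀ z ∈ Icc (0 : ℝ) 1, ∀ y ∈ Metric.closedBall x₀ R, ∀ w ∈ Metric.closedBall x₀ R,
      ‖fderiv ℝ (fderiv ℝ fun y => K.φ y t z) y - fderiv ℝ (fderiv ℝ fun y => K.φ y t z) w‖ ≤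
        C := by
    intro z hz y hy w hw
    refine (norm_fderiv_fderiv_sub_le y w).trans (((hC z hz).dist_le (hsub hy) (hsub hw)).trans ?_)
    have hd : dist y w ≤ 1 := by
      have := dist_triangle_right y w x₀
      rw [Metric.mem_closedBall] at hy hw
      have := min_le_right R' (1 / 2)
      linarith
    exact mul_le_of_le_one_right C.coe_nonneg (Real.rpow_le_one dist_nonneg hd α.coe_nonneg)
  have hball : ∀ y ∈ Metric.closedBall x₀ (R / 2), Metric.closedBall y (R / 2) ⊆
      Metric.closedBall x₀ R := fun y hy =>
    Metric.closedBall_subset_closedBall' (by rw [Metric.mem_closedBall] at hy; linarith)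
  set M₁ := M₀ / (R / 2) + C / 2 * (R / 2)
  have h1 : ∀ z ∈ Icc (0 : ℝ) 1, ∀ y ∈ Metric.closedBall x₀ (R / 2),
      ‖fderiv ℝ (fun y => K.φ y t z) y‖ ≤ M₁ := fun z hz y hy =>
    norm_fderiv_le_of_osc (by positivity) (fun w hw => hC2 z hz w (hball y hy hw))
      (fun w hw => h0 z hz w (hball y hy hw))
      fun w hw w' hw' => hosc z hz w (hball y hy hw) w' (hball y hy hw')
  have hball' : ∀ y ∈ Metric.closedBall x₀ (R / 4), Metric.closedBall y (R / 4) ⊆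
      Metric.closedBall x₀ (R / 2) := fun y hy =>
    Metric.closedBall_subset_closedBall' (by rw [Metric.mem_closedBall] at hy; linarith)
  have hle : Metric.closedBall x₀ (R / 2) ⊆ Metric.closedBall x₀ R :=
    Metric.closedBall_subset_closedBall (by linarith)
  have hle' : Metric.closedBall x₀ (R / 4) ⊆ Metric.closedBall x₀ (R / 2) :=
    Metric.closedBall_subset_closedBall (by linarith)
  set M₂ := 2 * M₁ / (R / 4) + C
  have h2 : ∀ z ∈ Icc (0 : ℝ) 1, ∀ y ∈ Metric.closedBall x₀ (R / 4),
      ‖fderiv ℝ (fderiv ℝ fun y => K.φ y t z) y‖ ≤ M₂ := fun z hz y hy =>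
    norm_fderiv_le_of_norm_sub_le (by positivity)
      (fun w hw => (hC2 z hz w (hle (hball' y hy hw))).differentiableAt_fderiv)
      (fun w hw => h1 z hz w (hball' y hy hw))
      fun w hw => hosc z hz w (hle (hball' y hy hw)) y (hle (hle' hy))
  refine ⟨R / 4, M₀ + M₁ + M₂, by positivity, by positivity,
    (hle'.trans hle).trans (hsub.trans hsU), fun z hz y hy => ⟨?_, ?_, ?_⟩⟩
  · exact (h0 z hz y (hle (hle' hy))).trans
      (by have : 0 ≤ M₁ + M₂ := by positivity
          linarith)
  · exact (h1 z hz y (hle' hy)).trans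
      (by have : 0 ≤ M₀ + M₂ := by positivity
          linarith)
  · exact (h2 z hz y hy).trans
      (by have : 0 ≤ M₀ + M₁ := by positivity
          linarith)

end JumpBounds

section ParametricIntegral

variable {n : ℕ} {α : Type*} [MeasurableSpace α] {μ : Measure α}

theorem aestronglyMeasurable_of_hasFDerivAt {Φ : (Fin n → ℝ) → α → ℝ}
    {Φ' : α → (Fin n → ℝ) →L[ℝ] ℝ} {U : Set (Fin n → ℝ)} {x : Fin n → ℝ} (hU : U ∈ 𝓝 x)
    (hmeas : ∀ x ∈ U, AEStronglyMeasurable (Φ x) μ)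
    (hd : ∀ᵐ z ∂μ, HasFDerivAt (fun x => Φ x z) (Φ' z) x) : AEStronglyMeasurable Φ' μ := by
  have hdir : ∀ e : Fin n → ℝ, AEStronglyMeasurable (fun z => Φ' z e) μ := by
    intro e
    have hlim : Tendsto (fun k : ℕ => x + ((k : ℝ) + 1)⁻¹ • e) atTop (𝓝 x) := by
      have h1 : Tendsto (fun k : ℕ => ((k : ℝ) + 1)⁻¹) atTop (𝓝 0) := by
        simpa [one_div] using tendsto_one_div_add_atTop_nhds_zero_nat (𝕜 := ℝ)
      simpa using (h1.smul_const e).const_add x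
    obtain ⟨N, hN⟩ := eventually_atTop.1 (hlim.eventually hU)
    refine aestronglyMeasurable_of_tendsto_ae atTop
      (f := fun k z => ((N + k : ℕ) + 1 : ℝ) • (Φ (x + (((N + k : ℕ) : ℝ) + 1)⁻¹ • e) z - Φ x z))
      (fun k => ((hmeas _ (hN (N + k) (by omega))).sub (hmeas x (mem_of_mem_nhds hU))).const_smul
        (((N + k : ℕ) : ℝ) + 1))
      ?_
    filter_upwards [hd] with z hz
    have hc : Tendsto (fun k : ℕ => (((N + k : ℕ) : ℝ) + 1)) atTop atTop :=
      tendsto_atTop_add_const_right _ _ (tendsto_natCast_atTop_atTop.comp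
        (tendsto_atTop_mono (fun k => Nat.le_add_left k N) tendsto_id))
    have := hz.lim (f := fun x => Φ x z) e (c := fun k : ℕ => (((N + k : ℕ) : ℝ) + 1))
      (l := atTop) (tendsto_norm_atTop_atTop.comp hc)
    simpa using this
  have hsum : Φ' = fun z => ∑ i, Φ' z (Pi.single i 1) •
      ContinuousLinearMap.proj (R := ℝ) (φ := fun _ : Fin n => ℝ) i := by
    ext z e
    conv_lhs => rw [← Finset.univ_sum_single e]
    rw [map_sum, _root_.sum_apply]
    refine Finset.sum_congr rfl fun i _ => ?_
    have : (Pi.single i (e i) : Fin n → ℝ) = e i • Pi.single i 1 := by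
      rw [← Pi.single_smul]; simp
    rw [this, map_smul]
    simp [mul_comm]
  rw [hsum]
  exact Finset.aestronglyMeasurable_fun_sum _ fun i _ => (hdir _).smul_const _

theorem hasFDerivAt_integral_of_bounded [IsFiniteMeasure μ] {Φ : (Fin n → ℝ) → α → ℝ}
    {Φ' : (Fin n → ℝ) → α → (Fin n → ℝ) →L[ℝ] ℝ} {U : Set (Fin n → ℝ)} (hU : IsOpen U) {M M' : ℝ}
    (hmeas : ∀ x ∈ U, AEStronglyMeasurable (Φ x) μ) (hM : ∀ᵐ z ∂μ, ∀ x ∈ U, |Φ x z| ≤ M)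
    (hd : ∀ᵐ z ∂μ, ∀ x ∈ U, HasFDerivAt (fun x => Φ x z) (Φ' x z) x)
    (hM' : ∀ᵐ z ∂μ, ∀ x ∈ U, ‖Φ' x z‖ ≤ M') {x : Fin n → ℝ} (hx : x ∈ U) :
    HasFDerivAt (fun x => ∫ z, Φ x z ∂μ) (∫ z, Φ' x z ∂μ) x ∧ Integrable (Φ' x) μ := by
  have hm : AEStronglyMeasurable (Φ' x) μ := aestronglyMeasurable_of_hasFDerivAt
    (hU.mem_nhds hx) hmeas (hd.mono fun z hz => hz x hx)
  refine ⟨hasFDerivAt_integral_of_dominated_of_fderiv_le (bound := fun _ => M')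
    (hU.mem_nhds hx) ?_ ?_ hm hM' (integrable_const _) hd, ?_⟩
  · filter_upwards [hU.mem_nhds hx] with y hy using hmeas y hy
  · exact Integrable.of_bound (hmeas x hx) M (hM.mono fun z hz => hz x hx)
  · exact Integrable.of_bound hm M' (hM'.mono fun z hz => hz x hx)

/-- Differentiating twice under the integral sign in a fixed direction. -/
theorem hasFDerivAt_fderiv_integral_of_bounded [IsFiniteMeasure μ] {Φ : (Fin n → ℝ) → α → ℝ}
    {Φ' Φ'' : (Fin n → ℝ) → α → (Fin n → ℝ) →L[ℝ] ℝ} {U : Set (Fin n → ℝ)} (hU : IsOpen U)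
    {M M' M'' : ℝ} (v : Fin n → ℝ)
    (hmeas : ∀ x ∈ U, AEStronglyMeasurable (Φ x) μ) (hM : ∀ᵐ z ∂μ, ∀ x ∈ U, |Φ x z| ≤ M)
    (hd : ∀ᵐ z ∂μ, ∀ x ∈ U, HasFDerivAt (fun x => Φ x z) (Φ' x z) x)
    (hM' : ∀ᵐ z ∂μ, ∀ x ∈ U, ‖Φ' x z‖ ≤ M')
    (hd' : ∀ᵐ z ∂μ, ∀ x ∈ U, HasFDerivAt (fun x => Φ' x z v) (Φ'' x z) x)
    (hM'' : ∀ᵐ z ∂μ, ∀ x ∈ U, ‖Φ'' x z‖ ≤ M'') {x : Fin n → ℝ} (hx : x ∈ U) :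
    (∀ᶠ y in 𝓝 x, DifferentiableAt ℝ (fun x => ∫ z, Φ x z ∂μ) y) ∧
    HasFDerivAt (fun y => fderiv ℝ (fun x => ∫ z, Φ x z ∂μ) y v) (∫ z, Φ'' x z ∂μ) x ∧
    Integrable (Φ'' x) μ := by
  have h1 := fun y hy => hasFDerivAt_integral_of_bounded hU hmeas hM hd hM' (x := y) hy
  have h2 := hasFDerivAt_integral_of_bounded (Φ := fun x z => Φ' x z v) (M := M' * ‖v‖) hU
    (fun y hy => (h1 y hy).2.aestronglyMeasurable.apply_continuousLinearMap v)
    (hM'.mono fun z hz y hy => ((Φ' y z).le_opNorm v).trans (by gcongr; exact hz y hy))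
    hd' hM'' hx
  refine ⟨?_, h2.1.congr_of_eventuallyEq ?_, h2.2⟩
  · filter_upwards [hU.mem_nhds hx] with y hy using (h1 y hy).1.differentiableAt
  · filter_upwards [hU.mem_nhds hx] with y hy
    rw [(h1 y hy).1.fderiv, ContinuousLinearMap.integral_apply (h1 y hy).2]

end ParametricIntegral

section JumpIntegrand

variable {E : Type*} [NormedAddCommGroup E] [NormedSpace ℝ E] {h : E → ℝ} {ψ : E → E} {x v : E}

/-- The compensated increment of `h` along the jump `ψ`. -/
def jumpIncrement (h : E → ℝ) (ψ : E → E) (x : E) : ℝ :=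
  h (x + ψ x) - h x - fderiv ℝ h x (ψ x)

/-- The derivative of `jumpIncrement h ψ`. -/
def jumpFDeriv (h : E → ℝ) (ψ : E → E) (x : E) : E →L[ℝ] ℝ :=
  (fderiv ℝ h (x + ψ x)).comp (ContinuousLinearMap.id ℝ E + fderiv ℝ ψ x) - fderiv ℝ h x -
    ((fderiv ℝ h x).comp (fderiv ℝ ψ x) + (fderiv ℝ (fderiv ℝ h) x).flip (ψ x))

/-- The derivative of the directional derivative of `jumpIncrement h ψ` along `v`. -/
def jumpFDerivDir (h : E → ℝ) (ψ : E → E) (v x : E) : E →L[ℝ] ℝ :=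
  (fderiv ℝ h (x + ψ x)).comp ((fderiv ℝ (fderiv ℝ ψ) x).flip v) +
      ((fderiv ℝ (fderiv ℝ h) (x + ψ x)).comp
        (ContinuousLinearMap.id ℝ E + fderiv ℝ ψ x)).flip (v + fderiv ℝ ψ x v) -
    (fderiv ℝ (fderiv ℝ h) x).flip v -
    ((fderiv ℝ h x).comp ((fderiv ℝ (fderiv ℝ ψ) x).flip v) +
        (fderiv ℝ (fderiv ℝ h) x).flip (fderiv ℝ ψ x v) +
      ((fderiv ℝ (fderiv ℝ h) x v).comp (fderiv ℝ ψ x) +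
        (fderiv ℝ (fun y => fderiv ℝ (fderiv ℝ h) y v) x).flip (ψ x)))

theorem ContDiff.hasFDerivAt_jumpIncrement (hh : ContDiff ℝ 4 h) (hψ : ContDiffAt ℝ 2 ψ x) :
    HasFDerivAt (jumpIncrement h ψ) (jumpFDeriv h ψ x) x := by
  have hd : Differentiable ℝ h := hh.differentiable (by norm_num)
  have hd2 : Differentiable ℝ (fderiv ℝ h) :=
    (hh.fderiv_right (m := 3) (by norm_num)).differentiable (by norm_num)
  have h1 : HasFDerivAt ψ (fderiv ℝ ψ x) x := (hψ.differentiableAt (by norm_num)).hasFDerivAt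
  exact (((hd _).hasFDerivAt.comp x ((hasFDerivAt_id x).add h1)).sub (hd x).hasFDerivAt).sub
    ((hd2 x).hasFDerivAt.clm_apply h1)

theorem ContDiff.hasFDerivAt_jumpFDeriv_apply (hh : ContDiff ℝ 4 h) (hψ : ContDiffAt ℝ 2 ψ x)
    (v : E) : HasFDerivAt (fun y => jumpFDeriv h ψ y v) (jumpFDerivDir h ψ v x) x := by
  have hc2 : ContDiff ℝ 3 (fderiv ℝ h) := hh.fderiv_right (by norm_num)
  have hd2 : Differentiable ℝ (fderiv ℝ h) := hc2.differentiable (by norm_num)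
  have hd3 : Differentiable ℝ (fderiv ℝ (fderiv ℝ h)) :=
    (hc2.fderiv_right (m := 2) (by norm_num)).differentiable (by norm_num)
  have h1 : HasFDerivAt ψ (fderiv ℝ ψ x) x := (hψ.differentiableAt (by norm_num)).hasFDerivAt
  have h2 : HasFDerivAt (fun y => fderiv ℝ ψ y v) ((fderiv ℝ (fderiv ℝ ψ) x).flip v) x := by
    simpa using hψ.differentiableAt_fderiv.hasFDerivAt.clm_apply (hasFDerivAt_const v x)
  have h3 : HasFDerivAt (fun y => fderiv ℝ h y v) ((fderiv ℝ (fderiv ℝ h) x).flip v) x := by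
    simpa using (hd2 x).hasFDerivAt.clm_apply (hasFDerivAt_const v x)
  have h4 : HasFDerivAt (fun y => fderiv ℝ h (y + ψ y)) ((fderiv ℝ (fderiv ℝ h) (x + ψ x)).comp
      (ContinuousLinearMap.id ℝ E + fderiv ℝ ψ x)) x :=
    (hd2 _).hasFDerivAt.comp x ((hasFDerivAt_id x).add h1)
  have h5 : HasFDerivAt (fun y => fderiv ℝ (fderiv ℝ h) y v)
      (fderiv ℝ (fun y => fderiv ℝ (fderiv ℝ h) y v) x) x :=
    ((hd3 x).clm_apply (differentiableAt_const v)).hasFDerivAt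
  exact ((h4.clm_apply (h2.const_add v)).sub h3).sub
    (((hd2 x).hasFDerivAt.clm_apply h2).add (h5.clm_apply h1))

theorem jumpFDerivDir_apply (w : E) : jumpFDerivDir h ψ v x w =
    fderiv ℝ h (x + ψ x) (fderiv ℝ (fderiv ℝ ψ) x w v) +
      fderiv ℝ (fderiv ℝ h) (x + ψ x) (w + fderiv ℝ ψ x w) (v + fderiv ℝ ψ x v) -
    fderiv ℝ (fderiv ℝ h) x w v -
    (fderiv ℝ h x (fderiv ℝ (fderiv ℝ ψ) x w v) + fderiv ℝ (fderiv ℝ h) x w (fderiv ℝ ψ x v) +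
      (fderiv ℝ (fderiv ℝ h) x v (fderiv ℝ ψ x w) +
        fderiv ℝ (fun y => fderiv ℝ (fderiv ℝ h) y v) x w (ψ x))) := rfl

variable {M H H' : ℝ}

theorem abs_jumpIncrement_le (hh : Differentiable ℝ h) (h1 : ∀ y, ‖fderiv ℝ h y‖ ≤ H)
    (hψ : ‖ψ x‖ ≤ M) : |jumpIncrement h ψ x| ≤ H * M + H * M := by
  have hH : 0 ≤ H := (norm_nonneg _).trans (h1 x)
  have e1 : ‖h (x + ψ x) - h x‖ ≤ H * M := by
    refine (convex_univ.norm_image_sub_le_of_norm_fderiv_le (fun y _ => hh y) (fun y _ => h1 y)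
      (mem_univ x) (mem_univ (x + ψ x))).trans ?_
    rw [add_sub_cancel_left]
    gcongr
  exact (norm_sub_le _ _).trans (add_le_add e1 ((fderiv ℝ h x).le_of_opNorm_le_of_le (h1 x) hψ))

theorem norm_jumpFDeriv_le (h1 : ∀ y, ‖fderiv ℝ h y‖ ≤ H)
    (h2 : ‖fderiv ℝ (fderiv ℝ h) x‖ ≤ H) (hψ : ‖ψ x‖ ≤ M) (hψ1 : ‖fderiv ℝ ψ x‖ ≤ M) :
    ‖jumpFDeriv h ψ x‖ ≤ H * (1 + M) + H + (H * M + H * M) := by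
  have hH : 0 ≤ H := (norm_nonneg _).trans (h1 x)
  have hM : 0 ≤ M := (norm_nonneg _).trans hψ
  refine ContinuousLinearMap.opNorm_le_bound _ (by positivity) fun w => ?_
  have e1 : ‖fderiv ℝ ψ x w‖ ≤ M * ‖w‖ := (fderiv ℝ ψ x).le_of_opNorm_le hψ1 w
  have e2 : ‖w + fderiv ℝ ψ x w‖ ≤ (1 + M) * ‖w‖ :=
    (norm_add_le _ _).trans (by linarith)
  have a1 : ‖fderiv ℝ h (x + ψ x) (w + fderiv ℝ ψ x w)‖ ≤ H * ((1 + M) * ‖w‖) :=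
    (fderiv ℝ h (x + ψ x)).le_of_opNorm_le_of_le (h1 _) e2
  have a2 : ‖fderiv ℝ h x w‖ ≤ H * ‖w‖ := (fderiv ℝ h x).le_of_opNorm_le (h1 _) w
  have a3 : ‖fderiv ℝ h x (fderiv ℝ ψ x w)‖ ≤ H * (M * ‖w‖) :=
    (fderiv ℝ h x).le_of_opNorm_le_of_le (h1 _) e1
  have a4 : ‖fderiv ℝ (fderiv ℝ h) x w (ψ x)‖ ≤ H * ‖w‖ * M :=
    (fderiv ℝ (fderiv ℝ h) x w).le_of_opNorm_le_of_le
      ((fderiv ℝ (fderiv ℝ h) x).le_of_opNorm_le h2 w) hψ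
  have : ‖jumpFDeriv h ψ x w‖ ≤ H * ((1 + M) * ‖w‖) + H * ‖w‖ + (H * (M * ‖w‖) + H * ‖w‖ * M) :=
    (norm_sub_le _ _).trans (add_le_add ((norm_sub_le _ _).trans (add_le_add a1 a2))
      ((norm_add_le _ _).trans (add_le_add a3 a4)))
  linarith

theorem norm_jumpFDerivDir_le (h1 : ∀ y, ‖fderiv ℝ h y‖ ≤ H)
    (h2 : ∀ y, ‖fderiv ℝ (fderiv ℝ h) y‖ ≤ H)
    (h3 : ‖fderiv ℝ (fun y => fderiv ℝ (fderiv ℝ h) y v) x‖ ≤ H')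
    (hψ : ‖ψ x‖ ≤ M) (hψ1 : ‖fderiv ℝ ψ x‖ ≤ M) (hψ2 : ‖fderiv ℝ (fderiv ℝ ψ) x‖ ≤ M) :
    ‖jumpFDerivDir h ψ v x‖ ≤ H * (M * ‖v‖) + H * (1 + M) * ((1 + M) * ‖v‖) + H * ‖v‖ +
      (H * (M * ‖v‖) + H * (M * ‖v‖) + (H * ‖v‖ * M + H' * M)) := by
  have hH : 0 ≤ H := (norm_nonneg _).trans (h1 x)
  have hM : 0 ≤ M := (norm_nonneg _).trans hψ
  have hH' : 0 ≤ H' :=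
    (norm_nonneg (fderiv ℝ (fun y => fderiv ℝ (fderiv ℝ h) y v) x)).trans h3
  refine ContinuousLinearMap.opNorm_le_bound _ (by positivity) fun w => ?_
  have e1 : ∀ u, ‖fderiv ℝ ψ x u‖ ≤ M * ‖u‖ := (fderiv ℝ ψ x).le_of_opNorm_le hψ1
  have e2 : ∀ u, ‖u + fderiv ℝ ψ x u‖ ≤ (1 + M) * ‖u‖ := fun u =>
    (norm_add_le _ _).trans (by linarith [e1 u])
  have e3 : ‖fderiv ℝ (fderiv ℝ ψ) x w v‖ ≤ M * ‖w‖ * ‖v‖ :=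
    (fderiv ℝ (fderiv ℝ ψ) x w).le_of_opNorm_le
      ((fderiv ℝ (fderiv ℝ ψ) x).le_of_opNorm_le hψ2 w) v
  have key : ∀ y (u u' : E), ‖fderiv ℝ (fderiv ℝ h) y u u'‖ ≤ H * ‖u‖ * ‖u'‖ := fun y u u' =>
    (fderiv ℝ (fderiv ℝ h) y u).le_of_opNorm_le
      ((fderiv ℝ (fderiv ℝ h) y).le_of_opNorm_le (h2 y) u) u'
  have a1 : ∀ y, ‖fderiv ℝ h y (fderiv ℝ (fderiv ℝ ψ) x w v)‖ ≤ H * (M * ‖w‖ * ‖v‖) := fun y =>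
    (fderiv ℝ h y).le_of_opNorm_le_of_le (h1 _) e3
  have a2 : ‖fderiv ℝ (fderiv ℝ h) (x + ψ x) (w + fderiv ℝ ψ x w) (v + fderiv ℝ ψ x v)‖ ≤
      H * ((1 + M) * ‖w‖) * ((1 + M) * ‖v‖) :=
    (key _ _ _).trans (mul_le_mul (mul_le_mul_of_nonneg_left (e2 w) hH) (e2 v)
      (norm_nonneg _) (by positivity))
  have a3 : ‖fderiv ℝ (fderiv ℝ h) x w (fderiv ℝ ψ x v)‖ ≤ H * ‖w‖ * (M * ‖v‖) :=
    (key _ _ _).trans (mul_le_mul_of_nonneg_left (e1 v) (by positivity))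
  have a4 : ‖fderiv ℝ (fderiv ℝ h) x v (fderiv ℝ ψ x w)‖ ≤ H * ‖v‖ * (M * ‖w‖) :=
    (key _ _ _).trans (mul_le_mul_of_nonneg_left (e1 w) (by positivity))
  have a5 : ‖fderiv ℝ (fun y => fderiv ℝ (fderiv ℝ h) y v) x w (ψ x)‖ ≤ H' * ‖w‖ * M :=
    (fderiv ℝ (fun y => fderiv ℝ (fderiv ℝ h) y v) x w).le_of_opNorm_le_of_le
      ((fderiv ℝ (fun y => fderiv ℝ (fderiv ℝ h) y v) x).le_of_opNorm_le h3 w) hψ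
  have : ‖jumpFDerivDir h ψ v x w‖ ≤ H * (M * ‖w‖ * ‖v‖) + H * ((1 + M) * ‖w‖) * ((1 + M) * ‖v‖) +
      H * ‖w‖ * ‖v‖ + (H * (M * ‖w‖ * ‖v‖) + H * ‖w‖ * (M * ‖v‖) +
        (H * ‖v‖ * (M * ‖w‖) + H' * ‖w‖ * M)) :=
    (norm_sub_le _ _).trans (add_le_add ((norm_sub_le _ _).trans
      (add_le_add ((norm_add_le _ _).trans (add_le_add (a1 _) a2)) (key _ _ _)))
      ((norm_add_le _ _).trans (add_le_add ((norm_add_le _ _).trans (add_le_add (a1 _) a3))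
        ((norm_add_le _ _).trans (add_le_add a4 a5)))))
  linarith

end JumpIntegrand

section JumpOperator

variable {n : ℕ} {T : ℝ}

/-- Twofold differentiability of `Bh` for a test function `h` with bounded derivatives. -/
theorem hasFDerivAt_fderiv_Bop (K : JumpKernel n T) (lam : ℝ → ℝ) {t : ℝ} (ht : t ∈ Icc (0 : ℝ) T)
    {x₀ : Fin n → ℝ} (hx₀ : x₀ ∈ posOrth n) {h : (Fin n → ℝ) → ℝ} (hh : ContDiff ℝ 4 h) {H : ℝ}
    (h1 : ∀ y, ‖fderiv ℝ h y‖ ≤ H) (h2 : ∀ y, ‖fderiv ℝ (fderiv ℝ h) y‖ ≤ H) (v : Fin n → ℝ) :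
    (∀ᶠ y in 𝓝 x₀, DifferentiableAt ℝ (fun y => Bop lam K h y t) y) ∧
    HasFDerivAt (fun y => fderiv ℝ (fun y => Bop lam K h y t) y v)
      (lam t • ∫ z in Icc (0 : ℝ) 1, jumpFDerivDir h (fun y => K.φ y t z) v x₀) x₀ ∧
    IntegrableOn (fun z => jumpFDerivDir h (fun y => K.φ y t z) v x₀) (Icc 0 1) := by
  obtain ⟨r, M, hr, hM, hsub, hb⟩ := K.exists_uniform_bounds ht hx₀
  have hc2 : ContDiff ℝ 3 (fderiv ℝ h) := hh.fderiv_right (by norm_num)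
  have hc3 : ContDiff ℝ 2 (fderiv ℝ (fderiv ℝ h)) := hc2.fderiv_right (by norm_num)
  have hd : Differentiable ℝ h := hh.differentiable (by norm_num)
  have hq : ContDiff ℝ 2 (fun y => fderiv ℝ (fderiv ℝ h) y v) := hc3.clm_apply contDiff_const
  obtain ⟨H', h3⟩ := (isCompact_closedBall x₀ r).exists_norm_fderiv_le
    (g := fun y => fderiv ℝ (fderiv ℝ h) y v)
    fun x _ => (hq.of_le (by norm_num)).contDiffAt
  have hU : Metric.ball x₀ r ⊆ Metric.closedBall x₀ r := Metric.ball_subset_closedBall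
  have hmem : ∀ᵐ z ∂(volume.restrict (Icc (0 : ℝ) 1)), z ∈ Icc (0 : ℝ) 1 :=
    ae_restrict_mem measurableSet_Icc
  have hψ : ∀ z ∈ Icc (0 : ℝ) 1, ∀ x ∈ Metric.ball x₀ r,
      ContDiffAt ℝ 2 (fun y => K.φ y t z) x := fun z hz x hx =>
    (K.smooth t ht z hz).contDiffAt ((isOpen_posOrth n).mem_nhds (hsub (hU hx)))
  obtain ⟨r1, r2, r3⟩ := hasFDerivAt_fderiv_integral_of_bounded
    (μ := volume.restrict (Icc (0 : ℝ) 1)) (U := Metric.ball x₀ r) (x := x₀)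
    (Φ := fun x z => jumpIncrement h (fun y => K.φ y t z) x)
    (Φ' := fun x z => jumpFDeriv h (fun y => K.φ y t z) x)
    (Φ'' := fun x z => jumpFDerivDir h (fun y => K.φ y t z) v x) Metric.isOpen_ball v
    (fun x hx => by
      have hm := K.meas x (hsub (hU hx)) t ht
      have hm1 : Measurable fun z => h (x + K.φ x t z) :=
        hh.continuous.measurable.comp (measurable_const.add hm)
      have hm2 : Measurable fun z => fderiv ℝ h x (K.φ x t z) :=
        (fderiv ℝ h x).continuous.measurable.comp hm
      exact ((hm1.sub_const (h x)).sub hm2).aestronglyMeasurable)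
    (hmem.mono fun z hz x hx => abs_jumpIncrement_le hd h1 (hb z hz x (hU hx)).1)
    (hmem.mono fun z hz x hx => hh.hasFDerivAt_jumpIncrement (hψ z hz x hx))
    (hmem.mono fun z hz x hx => norm_jumpFDeriv_le h1 (h2 x) (hb z hz x (hU hx)).1
      (hb z hz x (hU hx)).2.1)
    (hmem.mono fun z hz x hx => hh.hasFDerivAt_jumpFDeriv_apply (hψ z hz x hx) v)
    (hmem.mono fun z hz x hx => norm_jumpFDerivDir_le h1 h2 (h3 x (hU hx)) (hb z hz x (hU hx)).1
      (hb z hz x (hU hx)).2.1 (hb z hz x (hU hx)).2.2)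
    (Metric.mem_ball_self hr)
  refine ⟨r1.mono fun y hy => hy.const_mul (lam t), ?_, r3⟩
  refine (r2.const_smul (lam t)).congr_of_eventuallyEq (r1.mono fun y hy => ?_)
  have := fderiv_const_mul hy (lam t)
  exact congrArg (fun L => L v) this

end JumpOperator

section Degenerate

variable {E : Type*} [NormedAddCommGroup E] [NormedSpace ℝ E] {h : E → ℝ} {ψ : E → E} {x v : E}

/-- If `∂_v² h` is nonnegative and vanishes at `x`, then the third derivative of `h` at `x` vanishes
whenever two of its arguments equal `v`. -/
theorem ContDiff.fderiv_fderiv_fderiv_apply_eq_zero (hh : ContDiff ℝ 4 h)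
    (hnn : ∀ y, 0 ≤ fderiv ℝ (fderiv ℝ h) y v v) (hv : fderiv ℝ (fderiv ℝ h) x v v = 0) (w : E) :
    fderiv ℝ (fun y => fderiv ℝ (fderiv ℝ h) y v) x v w = 0 := by
  have hc2 : ContDiff ℝ 3 (fderiv ℝ h) := hh.fderiv_right (by norm_num)
  have hd3 : Differentiable ℝ (fderiv ℝ (fderiv ℝ h)) :=
    (hc2.fderiv_right (m := 2) (by norm_num)).differentiable (by norm_num)
  have h1 : ∀ u, HasFDerivAt (fun y => fderiv ℝ (fderiv ℝ h) y u)
      ((fderiv ℝ (fderiv ℝ (fderiv ℝ h)) x).flip u) x := fun u => by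
    simpa using (hd3 x).hasFDerivAt.clm_apply (hasFDerivAt_const u x)
  have h2 : ∀ u u', HasFDerivAt (fun y => fderiv ℝ (fderiv ℝ h) y u u')
      (((fderiv ℝ (fderiv ℝ (fderiv ℝ h)) x).flip u).flip u') x := fun u u' => by
    simpa using (h1 u).clm_apply (hasFDerivAt_const u' x)
  have hmin : ∀ u, fderiv ℝ (fderiv ℝ (fderiv ℝ h)) x u v v = 0 := fun u => by
    have hloc : IsLocalMin (fun y => fderiv ℝ (fderiv ℝ h) y v v) x :=
      Eventually.of_forall fun y => hv.le.trans (hnn y)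
    have := hloc.hasFDerivAt_eq_zero (h2 v v)
    simpa using congrArg (fun L => L u) this
  have hs1 : fderiv ℝ (fderiv ℝ (fderiv ℝ h)) x v w = fderiv ℝ (fderiv ℝ (fderiv ℝ h)) x w v :=
    fderiv_fderiv_symm (hc2.of_le (by norm_num)).contDiffAt v w
  have hs2 : fderiv ℝ (fderiv ℝ (fderiv ℝ h)) x v v w =
      fderiv ℝ (fderiv ℝ (fderiv ℝ h)) x v w v := by
    have he : (fun y => fderiv ℝ (fderiv ℝ h) y v w) = fun y => fderiv ℝ (fderiv ℝ h) y w v :=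
      funext fun y => fderiv_fderiv_symm (hh.of_le (by norm_num)).contDiffAt v w
    have h3 := h2 v w
    rw [he] at h3
    simpa using congrArg (fun L => L v) (h3.unique (h2 w v))
  rw [(h1 v).fderiv, ContinuousLinearMap.flip_apply, hs2, hs1, hmin]

theorem abs_jumpFDerivDir_apply_le {C M δ : ℝ} (hδ : 0 < δ) (hh : ContDiff ℝ 4 h)
    (hnn : ∀ y u, 0 ≤ fderiv ℝ (fderiv ℝ h) y u u) (hv : fderiv ℝ (fderiv ℝ h) x v v = 0)
    (h1 : ∀ y, ‖fderiv ℝ h y‖ ≤ C * δ)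
    (h2 : ∀ y, ‖fderiv ℝ (fderiv ℝ h) y‖ * (δ + ‖y - x‖) ≤ C * δ)
    (hψ1 : ‖fderiv ℝ ψ x‖ ≤ M) (hψ2 : ‖fderiv ℝ (fderiv ℝ ψ) x‖ ≤ M) :
    |jumpFDerivDir h ψ v x v| ≤
      C * ((1 + M) * ‖v‖) ^ 2 * (δ / (δ + ‖ψ x‖)) + 2 * (C * (M * ‖v‖ * ‖v‖)) * δ := by
  have hM : 0 ≤ M := (norm_nonneg _).trans hψ1
  have hz : ∀ w, fderiv ℝ (fderiv ℝ h) x v w = 0 :=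
    ContinuousLinearMap.apply_eq_zero_of_nonneg
      (fun u w => fderiv_fderiv_symm (hh.of_le (by norm_num)).contDiffAt u w) (hnn x) hv
  rw [jumpFDerivDir_apply, hz, hz,
    hh.fderiv_fderiv_fderiv_apply_eq_zero (fun y => hnn y v) hv]
  simp only [add_zero, sub_zero]
  have e2 : ‖v + fderiv ℝ ψ x v‖ ≤ (1 + M) * ‖v‖ :=
    (norm_add_le _ _).trans (by linarith [(fderiv ℝ ψ x).le_of_opNorm_le hψ1 v])
  have e3 : ‖fderiv ℝ (fderiv ℝ ψ) x v v‖ ≤ M * ‖v‖ * ‖v‖ :=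
    (fderiv ℝ (fderiv ℝ ψ) x v).le_of_opNorm_le
      ((fderiv ℝ (fderiv ℝ ψ) x).le_of_opNorm_le hψ2 v) v
  have a1 : ∀ y, ‖fderiv ℝ h y (fderiv ℝ (fderiv ℝ ψ) x v v)‖ ≤ C * δ * (M * ‖v‖ * ‖v‖) :=
    fun y => (fderiv ℝ h y).le_of_opNorm_le_of_le (h1 _) e3
  have hpos : 0 < δ + ‖ψ x‖ := by positivity
  have b : ‖fderiv ℝ (fderiv ℝ h) (x + ψ x)‖ ≤ C * δ / (δ + ‖ψ x‖) := by
    rw [le_div_iff₀ hpos]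
    simpa using h2 (x + ψ x)
  have a2 : ‖fderiv ℝ (fderiv ℝ h) (x + ψ x) (v + fderiv ℝ ψ x v) (v + fderiv ℝ ψ x v)‖ ≤
      C * δ / (δ + ‖ψ x‖) * ((1 + M) * ‖v‖) * ((1 + M) * ‖v‖) :=
    (fderiv ℝ (fderiv ℝ h) (x + ψ x) (v + fderiv ℝ ψ x v)).le_of_opNorm_le_of_le
      ((fderiv ℝ (fderiv ℝ h) (x + ψ x)).le_of_opNorm_le_of_le b e2) e2
  have := (norm_sub_le _ _).trans
    (add_le_add ((norm_add_le _ _).trans (add_le_add (a1 (x + ψ x)) a2)) (a1 x))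
  rw [← Real.norm_eq_abs]
  refine this.trans (le_of_eq ?_)
  ring

end Degenerate

section Vanishing

variable {n : ℕ} {T : ℝ}

theorem JumpKernel.tendsto_integral_div_add_norm (K : JumpKernel n T) (hK : K.AENonzero) {t : ℝ}
    (ht : t ∈ Icc (0 : ℝ) T) {x : Fin n → ℝ} (hx : x ∈ posOrth n) :
    Tendsto (fun δ : ℝ => ∫ z in Icc (0 : ℝ) 1, δ / (δ + ‖K.φ x t z‖)) (𝓝[>] 0) (𝓝 0) := by
  have hlim := tendsto_integral_filter_of_dominated_convergence
    (μ := volume.restrict (Icc (0 : ℝ) 1)) (l := 𝓝[>] (0 : ℝ))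
    (F := fun δ z => δ / (δ + ‖K.φ x t z‖)) (f := fun _ => 0) (fun _ => (1 : ℝ))
    (Eventually.of_forall fun δ =>
      (measurable_const.div (measurable_const.add (K.meas x hx t ht).norm)).aestronglyMeasurable)
    (by
      filter_upwards [self_mem_nhdsWithin] with δ hδ
      have hδ : 0 < δ := hδ
      refine Eventually.of_forall fun z => ?_
      rw [Real.norm_of_nonneg (by positivity)]
      exact div_le_one_of_le₀ (by linarith [norm_nonneg (K.φ x t z)]) (by positivity))
    (integrable_const _)
    (by
      filter_upwards [hK x hx t ht] with z hz
      have hc : ContinuousAt (fun δ : ℝ => δ / (δ + ‖K.φ x t z‖)) 0 :=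
        continuousAt_id.div (continuousAt_id.add continuousAt_const) (by simpa using hz)
      simpa using hc.tendsto.mono_left nhdsWithin_le_nhds)
  simpa using hlim

theorem exists_convex_small_jump (J : JumpKernel n T) (hJ : J.AENonzero) (Dk : DiffKernel n T)
    {lam : ℝ → ℝ} (hlam : LamOK T lam) {t : ℝ} (ht : t ∈ Icc (0 : ℝ) T)
    {f : (Fin n → ℝ) → ℝ} (hf : MemTestClass n f) (hconv : ConvexOn ℝ (posOrth n) f)
    {x₀ : Fin n → ℝ} (hx₀ : x₀ ∈ posOrth n) {v : Fin n → ℝ} (hvv : dir2 f x₀ v = 0)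
    {ε : ℝ} (hε : 0 < ε) :
    ∃ h : (Fin n → ℝ) → ℝ, MemTestClass n h ∧ ConvexOn ℝ (posOrth n) h ∧ dir2 h x₀ v = 0 ∧
      dir2 (fun y => Aop Dk h y t) x₀ v = dir2 (fun y => Aop Dk f y t) x₀ v ∧
      |dir2 (fun y => Bop lam J h y t) x₀ v| ≤ ε ∧
      dir2 (fun y => Aop Dk h y t + Bop lam J h y t) x₀ v =
        dir2 (fun y => Aop Dk h y t) x₀ v + dir2 (fun y => Bop lam J h y t) x₀ v := by
  obtain ⟨C, κ, δ₁, hC, hδ₁, hloc⟩ := exists_localization hf hconv hx₀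
  obtain ⟨Cb, _, -, -, hCb⟩ := exists_barrier_bounds n
  obtain ⟨r, M, hr, hM, hsub, hb⟩ := J.exists_uniform_bounds ht hx₀
  set c₁ := C * ((1 + M) * ‖v‖) ^ 2
  set c₂ := 2 * (C * (M * ‖v‖ * ‖v‖))
  have hlim : Tendsto (fun δ : ℝ => lam t * (c₁ * (∫ z in Icc (0 : ℝ) 1, δ / (δ + ‖J.φ x₀ t z‖)) +
      c₂ * δ)) (𝓝[>] 0) (𝓝 0) := by
    have hid : Tendsto (fun δ : ℝ => δ) (𝓝[>] 0) (𝓝 0) := nhdsWithin_le_nhds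
    simpa using (((J.tendsto_integral_div_add_norm hJ ht hx₀).const_mul c₁).add
      (hid.const_mul c₂)).const_mul (lam t)
  obtain ⟨δ, hδε, hδ0, hδ1⟩ := ((hlim.eventually (gt_mem_nhds hε)).and
    (Ioo_mem_nhdsGT hδ₁)).exists
  obtain ⟨h, hhF, hh4, hnn, heq, h1, h2⟩ := hloc δ hδ0 hδ1
  have hU := (isOpen_posOrth n).mem_nhds hx₀
  have hf4 : ContDiffAt ℝ 4 f x₀ := hf.smooth.contDiffAt hU
  have hf2 : ContDiffAt ℝ 2 f x₀ := hf4.of_le (by norm_num)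
  have hh2 : ContDiff ℝ 2 h := hh4.of_le (by norm_num)
  have hb2 : ContDiffAt ℝ 2 (barrier δ x₀) x₀ := (contDiff_barrier hδ0 x₀).contDiffAt
  have hbz : fderiv ℝ (fderiv ℝ (barrier δ x₀)) x₀ v v = 0 := by
    have h0 := (hCb x₀ δ hδ0).2.2.1 x₀
    rw [sub_self, norm_zero, zero_pow (by norm_num), mul_zero] at h0
    have := (fderiv ℝ (fderiv ℝ (barrier δ x₀)) x₀ v).le_of_opNorm_le
      ((fderiv ℝ (fderiv ℝ (barrier δ x₀)) x₀).le_of_opNorm_le h0 v) v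
    simpa using this
  have hhv : fderiv ℝ (fderiv ℝ h) x₀ v v = 0 := by
    have e : fderiv ℝ (fderiv ℝ h) x₀ = fderiv ℝ (fderiv ℝ fun x => taylorRem f x₀ x +
        κ * barrier δ x₀ x) x₀ :=
      (EventuallyEq.fderiv (𝕜 := ℝ) heq).fderiv_eq
    rw [e, fderiv_fderiv_add_const_mul hf2.taylorRem hb2, fderiv_fderiv_taylorRem hf2]
    rw [dir2_eq hf2] at hvv
    rw [_root_.add_apply, _root_.add_apply, _root_.smul_apply, _root_.smul_apply, hvv, hbz]
    simp
  have h2' : ∀ y, ‖fderiv ℝ (fderiv ℝ h) y‖ ≤ C := fun y => by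
    refine le_of_mul_le_mul_right (le_trans ?_ (h2 y)) hδ0
    exact mul_le_mul_of_nonneg_left (by linarith [norm_nonneg (y - x₀)])
      (norm_nonneg (fderiv ℝ (fderiv ℝ h) y))
  obtain ⟨hB1, hB2, hB3⟩ := hasFDerivAt_fderiv_Bop J lam ht hx₀ hh4 (H := C * δ + C)
    (fun y => (h1 y).trans (by linarith)) (fun y => (h2' y).trans (by nlinarith)) v
  have hA2 := contDiffAt_Aop Dk ht hx₀ hh4.contDiffAt
  refine ⟨h, hhF, ?_, ?_, ?_, ?_, ?_⟩
  · exact (convexOn_univ_of_fderiv_fderiv_nonneg hh2 hnn).subset (subset_univ _) (convex_posOrth n)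
  · rw [dir2_eq hh2.contDiffAt, hhv]
  · exact dir2_Aop_eq_of_eventuallyEq Dk ht hx₀ hf4 (contDiff_barrier hδ0 x₀)
      (hCb x₀ δ hδ0).2.2.1 heq v
  · have hval : dir2 (fun y => Bop lam J h y t) x₀ v =
        lam t * ∫ z in Icc (0 : ℝ) 1, jumpFDerivDir h (fun y => J.φ y t z) v x₀ v := by
      rw [← ContinuousLinearMap.integral_apply hB3]
      exact congrArg (fun L => L v) hB2.fderiv
    have hpt : ∀ᵐ z ∂(volume.restrict (Icc (0 : ℝ) 1)),
        ‖jumpFDerivDir h (fun y => J.φ y t z) v x₀ v‖ ≤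
          c₁ * (δ / (δ + ‖J.φ x₀ t z‖)) + c₂ * δ := by
      filter_upwards [ae_restrict_mem measurableSet_Icc] with z hz
      have hbz := hb z hz x₀ (Metric.mem_closedBall_self hr.le)
      exact abs_jumpFDerivDir_apply_le hδ0 hh4 hnn hhv h1 h2 hbz.2.1 hbz.2.2
    have hint : Integrable (fun z => δ / (δ + ‖J.φ x₀ t z‖)) (volume.restrict (Icc (0 : ℝ) 1)) := by
      refine Integrable.of_bound (measurable_const.div (measurable_const.add
        (J.meas x₀ hx₀ t ht).norm)).aestronglyMeasurable 1 (Eventually.of_forall fun z => ?_)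
      rw [Real.norm_of_nonneg (by positivity)]
      exact div_le_one_of_le₀ (by linarith [norm_nonneg (J.φ x₀ t z)]) (by positivity)
    have hle := norm_integral_le_of_norm_le ((hint.const_mul c₁).add (integrable_const (c₂ * δ)))
      hpt
    have hsum : ∫ z in Icc (0 : ℝ) 1, (c₁ * (δ / (δ + ‖J.φ x₀ t z‖)) + c₂ * δ) =
        c₁ * (∫ z in Icc (0 : ℝ) 1, δ / (δ + ‖J.φ x₀ t z‖)) + c₂ * δ := by
      rw [integral_add (hint.const_mul c₁) (integrable_const _), integral_const_mul]
      simp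
    rw [hval, abs_mul, abs_of_nonneg (hlam.1 t ht)]
    exact (mul_le_mul_of_nonneg_left (hle.trans hsum.le) (hlam.1 t ht)).trans hδε.le
  · have hA1 : ∀ᶠ y in 𝓝 x₀, DifferentiableAt ℝ (fun y => Aop Dk h y t) y :=
      (hA2.eventually (by simp)).mono fun y hy => hy.differentiableAt (by norm_num)
    have hAd : DifferentiableAt ℝ (fun y => fderiv ℝ (fun y => Aop Dk h y t) y v) x₀ :=
      hA2.differentiableAt_fderiv.clm_apply (differentiableAt_const v)
    have he : (fun y => fderiv ℝ (fun y => Aop Dk h y t + Bop lam J h y t) y v) =ᶠ[𝓝 x₀]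
        fun y => fderiv ℝ (fun y => Aop Dk h y t) y v + fderiv ℝ (fun y => Bop lam J h y t) y v := by
      filter_upwards [hA1, hB1] with y hy hy'
      exact congrArg (fun L => L v) (fderiv_add hy hy')
    have := he.fderiv_eq.trans (fderiv_add hAd hB2.differentiableAt)
    exact congrArg (fun L => L v) this

end Vanishing

/-- Lemma 4.5: given `t₀ ∈ [0,T]` and a convex `f ∈ F` with `∂_v²f(x₀) = 0` at some
`x₀ ∈ (0,∞)ⁿ` and direction `v ≠ 0`, for any `ε > 0` there is a convex `h ∈ F` with
`∂_v²h(x₀) = 0`, `∂_v²(Ah)(x₀,t₀) = ∂_v²(Af)(x₀,t₀)` and `|∂_v²(Bh)(x₀,t₀)| ≤ ε`.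
Consequently, if `M = A + B` is LCP at all points, then `A` is LCP at all points. -/
theorem lcp_A_of_lcp_M {n : ℕ} {T : ℝ} (hT : 0 < T)
    (K : JumpKernel n T) (hK : K.AENonzero)
    (Dk : DiffKernel n T)
    (lam : ℝ → ℝ) (hlam : LamOK T lam)
    (t₀ : ℝ) (ht₀ : t₀ ∈ Set.Icc (0:ℝ) T)
    (f : (Fin n → ℝ) → ℝ) (hf : MemTestClass n f) (hconv : ConvexOn ℝ (posOrth n) f)
    (x₀ : Fin n → ℝ) (hx₀ : x₀ ∈ posOrth n)
    (v : Fin n → ℝ) (hv : v ≠ 0) (hvv : dir2 f x₀ v = 0)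
    (ε : ℝ) (hε : 0 < ε) :
    (∃ h : (Fin n → ℝ) → ℝ, MemTestClass n h ∧ ConvexOn ℝ (posOrth n) h ∧
      dir2 h x₀ v = 0 ∧
      dir2 (fun y => Aop Dk h y t₀) x₀ v = dir2 (fun y => Aop Dk f y t₀) x₀ v ∧
      |dir2 (fun y => Bop lam K h y t₀) x₀ v| ≤ ε) ∧
    ((∀ x ∈ posOrth n, ∀ t ∈ Set.Icc (0:ℝ) T,
        IsLCPAt (fun g y s => Aop Dk g y s + Bop lam K g y s) x t) →
      ∀ x ∈ posOrth n, ∀ t ∈ Set.Icc (0:ℝ) T, IsLCPAt (Aop Dk) x t) := by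
  refine ⟨?_, fun hM x hx t ht w hw g hg hgc hgw => ?_⟩
  · obtain ⟨h, h1, h2, h3, h4, h5, -⟩ :=
      exists_convex_small_jump K hK Dk hlam ht₀ hf hconv hx₀ hvv hε
    exact ⟨h, h1, h2, h3, h4, h5⟩
  · refine le_of_forall_pos_le_add fun η hη => ?_
    obtain ⟨h, h1, h2, h3, h4, h5, h6⟩ :=
      exists_convex_small_jump K hK Dk hlam ht hg hgc hx hgw hη
    have h7 := hM x hx t ht w hw h h1 h2 h3
    rw [h6, h4] at h7
    linarith [(abs_le.1 h5).2]

end
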